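/- arXiv:1503.06939 — 2 statements merged into one kernel-verified Lean document; each statement's English description precedes it below -/
import Mathlib

section
/- Uniform continuity with modulus bound: Assume (M), (J1), (J2), (F1)–(F4) hold. Then any bounded continuous viscosity solution u of F(u,Du,L[u,Du]) = f in ℝ^N is uniformly continuous, and its modulus of continuity ω_u(r) := sup{|u(x+y) − u(x)| : x ∈ ℝ^N, |y| < r} satisfies γ_M · ω_u(h) ≤ ω_f(h) for all h > 0, where M = ‖u‖_∞, γ_M is the constant from (F2), and ω_f is the modulus of continuity of f defined in the same way. -/
set_option autoImplicit false

open MeasureTheory Filter Topology Metric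
open scoped InnerProductSpace ENNReal NNReal

noncomputable section

/-- `ℝ^n` as a Euclidean space. -/
abbrev RE (n : ℕ) : Type := EuclideanSpace ℝ (Fin n)

/-- A modulus of continuity: nonnegative, subadditive, tending to `0` at `0⁺`. -/
def IsModulus (ω : ℝ → ℝ) : Prop :=
  (∀ s, 0 ≤ ω s) ∧ (∀ s t, ω (s + t) ≤ ω s + ω t) ∧
    Filter.Tendsto ω (𝓝[>] (0 : ℝ)) (𝓝 0)

/-- Boundedness of a real valued function. -/
def Bdd {N : ℕ} (u : RE N → ℝ) : Prop := ∃ C, ∀ x, |u x| ≤ C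

/-- Test functions: bounded `C²` functions. -/
def TestFn {N : ℕ} (φ : RE N → ℝ) : Prop := ContDiff ℝ 2 φ ∧ Bdd φ

/-- The quasilinear nonlocal operator `L = L₁ + L₂` acting on a (bounded `C²`)
function `φ`, where the jumps `j₁, j₂` depend on the gradient `Dφ(x)`. -/
def Lop {N P : ℕ} (μ₁ μ₂ : Measure (RE P)) (j₁ j₂ : RE N → RE P → RE N)
    (φ : RE N → ℝ) (x : RE N) : ℝ :=
  (∫ z, (φ (x + j₁ (gradient φ x) z) - φ x
      - ⟪j₁ (gradient φ x) z, gradient φ x⟫_ℝ) ∂μ₁)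
  + ∫ z, (φ (x + j₂ (gradient φ x) z) - φ x) ∂μ₂

/-- Viscosity subsolution of `F(u, Du, L[u,Du]) = f` in `ℝ^N`
(test-function formulation with bounded `C²` test functions and global maxima). -/
def IsSubSol {N P : ℕ} (μ₁ μ₂ : Measure (RE P)) (j₁ j₂ : RE N → RE P → RE N)
    (F : ℝ → RE N → ℝ → ℝ) (f : RE N → ℝ) (u : RE N → ℝ) : Prop :=
  ∀ φ : RE N → ℝ, TestFn φ → ∀ x : RE N, (∀ y, u y - φ y ≤ u x - φ x) →
    F (u x) (gradient φ x) (Lop μ₁ μ₂ j₁ j₂ φ x) ≤ f x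

/-- Viscosity supersolution of `F(u, Du, L[u,Du]) = f` in `ℝ^N`. -/
def IsSuperSol {N P : ℕ} (μ₁ μ₂ : Measure (RE P)) (j₁ j₂ : RE N → RE P → RE N)
    (F : ℝ → RE N → ℝ → ℝ) (f : RE N → ℝ) (u : RE N → ℝ) : Prop :=
  ∀ φ : RE N → ℝ, TestFn φ → ∀ x : RE N, (∀ y, u x - φ x ≤ u y - φ y) →
    f x ≤ F (u x) (gradient φ x) (Lop μ₁ μ₂ j₁ j₂ φ x)

/-- The modulus of continuity `ω_φ(h) = sup { |φ(x+y) - φ(x)| : x ∈ ℝ^N, |y| < h }`. -/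
def modCont {N : ℕ} (φ : RE N → ℝ) (h : ℝ) : ℝ :=
  sSup {d : ℝ | ∃ x y : RE N, ‖y‖ < h ∧ d = |φ (x + y) - φ x|}

/-- The nonlocal operator evaluated on an increment function `g` (standing for
`g j = φ (x + j) - φ x`) with prescribed gradient `p`. -/
def incOp {N P : ℕ} (μ₁ μ₂ : Measure (RE P)) (j₁ j₂ : RE N → RE P → RE N)
    (g : RE N → ℝ) (p : RE N) : ℝ :=
  (∫ z, (g (j₁ p z) - ⟪j₁ p z, p⟫_ℝ) ∂μ₁) + ∫ z, g (j₂ p z) ∂μ₂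

lemma integrable_norm_sq_and_integral_le {N P : ℕ} {μ : Measure (RE P)} {j : RE P → RE N} {C : ℝ}
    (hj : Measurable j) (hC : 0 ≤ C)
    (h : (∫⁻ z, (‖j z‖₊ : ℝ≥0∞) ^ 2 ∂μ) ≤ ENNReal.ofReal C) :
    Integrable (fun z => ‖j z‖ ^ 2) μ ∧ ∫ z, ‖j z‖ ^ 2 ∂μ ≤ C := by
  have hm : AEStronglyMeasurable (fun z => ‖j z‖ ^ 2) μ :=
    (hj.norm.pow_const 2).aestronglyMeasurable
  have heq : ∀ z, ENNReal.ofReal (‖j z‖ ^ 2) = (‖j z‖₊ : ℝ≥0∞) ^ 2 := fun z => by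
    rw [ENNReal.ofReal_pow (norm_nonneg _), ofReal_norm]; rfl
  have h' : (∫⁻ z, ENNReal.ofReal (‖j z‖ ^ 2) ∂μ) ≤ ENNReal.ofReal C := by
    simpa only [heq] using h
  constructor
  · refine ⟨hm, ?_⟩
    rw [hasFiniteIntegral_iff_ofReal (Eventually.of_forall fun z => by positivity)]
    exact h'.trans_lt ENNReal.ofReal_lt_top
  · rw [integral_eq_lintegral_of_nonneg_ae (Eventually.of_forall fun z => by positivity) hm]
    exact ENNReal.toReal_le_of_le_ofReal hC h'

/-- A bounded continuous function that is pinched between two paraboloids at the origin is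
approximated from above by test functions sharing its value and gradient there. -/
lemma exists_testFn_above {N : ℕ} {g : RE N → ℝ} {p : RE N} {C : ℝ} (hC : 0 ≤ C)
    (hgc : Continuous g) (hgb : Bdd g) (hg : ∀ j, |g j - ⟪j, p⟫_ℝ| ≤ C * ‖j‖ ^ 2)
    {τ : ℝ} (hτ : 0 < τ) :
    ∃ φ : RE N → ℝ, TestFn φ ∧ HasGradientAt φ p 0 ∧ φ 0 = 0 ∧
      ∀ j, g j ≤ φ j ∧ φ j ≤ g j + (2 * C + 1) * ‖j‖ ^ 2 ∧ φ j ≤ g j + τ := by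
  obtain ⟨s, hs, hs1⟩ : ∃ s : ℝ, 0 < s ∧ (2 * C + 1) * s ^ 2 ≤ τ := by
    refine ⟨Real.sqrt (τ / (2 * C + 1)), Real.sqrt_pos.2 (by positivity), ?_⟩
    rw [Real.sq_sqrt (by positivity)]
    field_simp
    exact le_rfl
  let χ : ContDiffBump (0 : RE N) := ⟨s / 2, s, by positivity, by linarith⟩
  obtain ⟨h, hhd, hh, -⟩ := (hgc.add (continuous_const (y := s ^ 2 / 8))).exists_contDiff_approx 2
    (continuous_const (y := s ^ 2 / 8)) (fun _ => by positivity)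
  have hh' : ∀ x, g x ≤ h x ∧ h x ≤ g x + s ^ 2 / 4 := fun x => by
    have := hh x
    simp only [Pi.add_apply] at this
    rw [Real.dist_eq, abs_lt] at this
    constructor <;> linarith [this.1, this.2]
  let Q : RE N → ℝ := fun j => ⟪j, p⟫_ℝ + C * ‖j‖ ^ 2
  have hQd : ContDiff ℝ 2 Q := by
    have : ContDiff ℝ 2 fun j : RE N => ‖j‖ ^ 2 := contDiff_norm_sq ℝ
    exact (contDiff_id.inner ℝ contDiff_const).add (contDiff_const.mul this)
  have hχd : ContDiff ℝ 2 χ := χ.contDiff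
  have hQ : ∀ j, g j ≤ Q j ∧ Q j ≤ g j + 2 * C * ‖j‖ ^ 2 := fun j => by
    have := abs_le.1 (hg j)
    constructor <;> simp only [Q] <;> linarith [this.1, this.2]
  have hχ0 : χ =ᶠ[𝓝 (0 : RE N)] 1 := χ.eventuallyEq_one
  have hbd : ∃ B, ∀ j, |χ j * Q j| ≤ B := by
    have hcs : HasCompactSupport fun j => χ j * Q j := χ.hasCompactSupport.mul_right
    obtain ⟨B, hB⟩ := (χ.continuous.mul hQd.continuous).bounded_above_of_compact_support hcs
    exact ⟨B, hB⟩
  refine ⟨fun j => χ j * Q j + (1 - χ j) * h j, ⟨?_, ?_⟩, ?_, ?_, ?_⟩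
  · exact (hχd.mul hQd).add ((contDiff_const.sub hχd).mul (by exact_mod_cast hhd))
  · obtain ⟨B, hB⟩ := hbd
    obtain ⟨B', hB'⟩ := hgb
    refine ⟨B + (B' + s ^ 2 / 4), fun j => (abs_add_le _ _).trans (add_le_add (hB j) ?_)⟩
    rw [abs_mul]
    have h1 : |1 - χ j| ≤ 1 := abs_le.2 ⟨by linarith [χ.le_one (x := j)], by
      linarith [χ.nonneg (x := j)]⟩
    have h2 : |h j| ≤ B' + s ^ 2 / 4 := by
      have := abs_le.1 (hB' j)
      have := hh' j
      have : 0 ≤ s ^ 2 / 4 := by positivity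
      exact abs_le.2 ⟨by linarith, by linarith⟩
    nlinarith [abs_nonneg (h j), abs_nonneg (1 - χ j)]
  · have hQg : HasGradientAt Q p 0 := by
      rw [hasGradientAt_iff_hasFDerivAt]
      have h1 : HasFDerivAt (fun j : RE N => ‖j‖ ^ 2) (2 • (innerSL ℝ (0 : RE N))) 0 :=
        (hasStrictFDerivAt_norm_sq (0 : RE N)).hasFDerivAt
      have h2 : HasFDerivAt (fun j : RE N => ⟪j, p⟫_ℝ) (innerSL ℝ p) 0 := by
        have := (innerSL ℝ p).hasFDerivAt (x := (0 : RE N))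
        refine this.congr_of_eventuallyEq (Eventually.of_forall fun j => ?_)
        simp [real_inner_comm]
      have h3 := h2.add (h1.const_mul C)
      refine h3.congr_fderiv ?_
      ext j
      simp
    refine hQg.congr_of_eventuallyEq ?_
    filter_upwards [hχ0] with j hj
    simp [hj]
  · have : χ 0 = 1 := hχ0.eq_of_nhds
    simp [this, Q]
  · intro j
    obtain ⟨h1, h2⟩ := hh' j
    obtain ⟨q1, q2⟩ := hQ j
    have c0 := χ.nonneg (x := j)
    have c1 := χ.le_one (x := j)
    have hlow : g j ≤ χ j * Q j + (1 - χ j) * h j := by nlinarith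
    have hup : χ j * Q j + (1 - χ j) * h j
        ≤ g j + χ j * (2 * C * ‖j‖ ^ 2) + (1 - χ j) * (s ^ 2 / 4) := by nlinarith
    have hin : (1 - χ j) * (s ^ 2 / 4) ≤ ‖j‖ ^ 2 := by
      by_cases hj : ‖j‖ ≤ s / 2
      · have : χ j = 1 := χ.one_of_mem_closedBall (by simpa using hj)
        rw [this]; simp
      · push Not at hj
        nlinarith
    have hout : χ j * (2 * C * ‖j‖ ^ 2) ≤ 2 * C * s ^ 2 := by
      by_cases hj : s ≤ ‖j‖
      · have : χ j = 0 := χ.zero_of_le_dist (by simpa using hj)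
        rw [this, zero_mul]; positivity
      · push Not at hj
        have h3 : ‖j‖ ^ 2 ≤ s ^ 2 := by gcongr
        calc χ j * (2 * C * ‖j‖ ^ 2) ≤ 1 * (2 * C * s ^ 2) := by gcongr
          _ = _ := one_mul _
    have hC2 : χ j * (2 * C * ‖j‖ ^ 2) ≤ 2 * C * ‖j‖ ^ 2 :=
      mul_le_of_le_one_left (by positivity) c1
    refine ⟨hlow, by linarith, ?_⟩
    have : (1 - χ j) * (s ^ 2 / 4) ≤ s ^ 2 := by nlinarith [sq_nonneg s]
    linarith

/-- The subsolution inequality holds for merely continuous functions touching from above, provided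
they are pinched between paraboloids at the contact point. -/
lemma IsSubSol.le_of_touching {N P : ℕ} {μ₁ μ₂ : Measure (RE P)} {j₁ j₂ : RE N → RE P → RE N}
    {F : ℝ → RE N → ℝ → ℝ} {f u : RE N → ℝ} (hu : IsSubSol μ₁ μ₂ j₁ j₂ F f u)
    [IsFiniteMeasure μ₂]
    (hj₁m : Measurable (Function.uncurry j₁)) (hj₂m : Measurable (Function.uncurry j₂))
    (hFc : Continuous fun t : ℝ × RE N × ℝ => F t.1 t.2.1 t.2.2)
    {y p : RE N} {g : RE N → ℝ} {C : ℝ} (hC : 0 ≤ C)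
    (hj : Integrable (fun z => ‖j₁ p z‖ ^ 2) μ₁)
    (hgc : Continuous g) (hgb : Bdd g) (hg : ∀ j, |g j - ⟪j, p⟫_ℝ| ≤ C * ‖j‖ ^ 2)
    (htouch : ∀ j, u (y + j) ≤ u y + g j) :
    F (u y) p (incOp μ₁ μ₂ j₁ j₂ g p) ≤ f y := by
  choose φ hφt hφg hφ0 hφ using fun n : ℕ =>
    exists_testFn_above hC hgc hgb hg (τ := 1 / ((n : ℝ) + 1)) (by positivity)
  have hj₁p : Measurable (j₁ p) := hj₁m.comp measurable_prodMk_left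
  have hj₂p : Measurable (j₂ p) := hj₂m.comp measurable_prodMk_left
  have hlim : ∀ j, Tendsto (fun n => φ n j) atTop (𝓝 (g j)) := fun j => by
    refine tendsto_of_tendsto_of_tendsto_of_le_of_le tendsto_const_nhds
      (h := fun n : ℕ => g j + 1 / ((n : ℝ) + 1)) ?_ (fun n => (hφ n j).1)
      (fun n => (hφ n j).2.2)
    simpa using tendsto_const_nhds.add (tendsto_one_div_add_atTop_nhds_zero_nat (𝕜 := ℝ))
  have hL : Tendsto (fun n => incOp μ₁ μ₂ j₁ j₂ (φ n) p) atTop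
      (𝓝 (incOp μ₁ μ₂ j₁ j₂ g p)) := by
    refine Tendsto.add ?_ ?_
    · refine tendsto_integral_of_dominated_convergence
        (fun z => (3 * C + 1) * ‖j₁ p z‖ ^ 2) (fun n => ?_) (hj.const_mul _)
        (fun n => Eventually.of_forall fun z => ?_)
        (Eventually.of_forall fun z => (hlim _).sub_const _)
      · exact (((hφt n).1.continuous.measurable.comp hj₁p).sub
          (hj₁p.inner measurable_const)).aestronglyMeasurable
      · have h1 := abs_le.1 (hg (j₁ p z))
        have h2 := hφ n (j₁ p z)
        have : 0 ≤ C * ‖j₁ p z‖ ^ 2 := by positivity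
        have : 0 ≤ ‖j₁ p z‖ ^ 2 := by positivity
        rw [Real.norm_eq_abs, abs_le]
        constructor <;> linarith [h1.1, h1.2, h2.1, h2.2.1]
    · obtain ⟨B, hB⟩ := hgb
      refine tendsto_integral_of_dominated_convergence
        (fun z => B + 1) (fun n => ?_) (integrable_const _)
        (fun n => Eventually.of_forall fun z => ?_)
        (Eventually.of_forall fun z => hlim _)
      · exact ((hφt n).1.continuous.measurable.comp hj₂p).aestronglyMeasurable
      · have h1 := abs_le.1 (hB (j₂ p z))
        have h2 := hφ n (j₂ p z)
        have h3 : 1 / ((n : ℝ) + 1) ≤ 1 := by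
          rw [div_le_one (by positivity)]; linarith [n.cast_nonneg (α := ℝ)]
        rw [Real.norm_eq_abs, abs_le]
        constructor <;> linarith [h1.1, h1.2, h2.1, h2.2.2]
  have hF : Tendsto (fun n => F (u y) p (incOp μ₁ μ₂ j₁ j₂ (φ n) p)) atTop
      (𝓝 (F (u y) p (incOp μ₁ μ₂ j₁ j₂ g p))) :=
    (hFc.tendsto (u y, p, incOp μ₁ μ₂ j₁ j₂ g p)).comp
      (tendsto_const_nhds.prodMk_nhds (tendsto_const_nhds.prodMk_nhds hL))
  refine le_of_tendsto hF (Eventually.of_forall fun n => ?_)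
  have hgrad : gradient (fun x => φ n (x - y)) y = p := by
    refine HasGradientAt.gradient ?_
    have h0 := hφg n
    rw [hasGradientAt_iff_hasFDerivAt] at h0 ⊢
    exact (hasFDerivAt_comp_sub y).2 (by rwa [sub_self])
  have key := hu (fun x => φ n (x - y)) ⟨(hφt n).1.comp (contDiff_id.sub contDiff_const), by
    obtain ⟨B, hB⟩ := (hφt n).2
    exact ⟨B, fun x => hB _⟩⟩ y (fun x => by
      have h1 := htouch (x - y)
      have h2 := (hφ n (x - y)).1
      rw [add_sub_cancel] at h1
      simp only [sub_self, hφ0]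
      linarith)
  simpa [Lop, incOp, hgrad, hφ0] using key

lemma IsSuperSol.neg_isSubSol {N P : ℕ} {μ₁ μ₂ : Measure (RE P)} {j₁ j₂ : RE N → RE P → RE N}
    {F : ℝ → RE N → ℝ → ℝ} {f u : RE N → ℝ} (hu : IsSuperSol μ₁ μ₂ j₁ j₂ F f u) :
    IsSubSol μ₁ μ₂ (fun p => j₁ (-p)) (fun p => j₂ (-p)) (fun a p l => -F (-a) (-p) (-l))
      (fun x => -f x) (fun x => -u x) := by
  intro φ hφ x hx
  have hgrad : gradient (fun y => -φ y) x = -gradient φ x := by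
    simp only [gradient, fderiv_fun_neg, map_neg]
  have key := hu (fun y => -φ y) ⟨hφ.1.neg, by
    obtain ⟨B, hB⟩ := hφ.2
    exact ⟨B, fun y => by simpa using hB y⟩⟩ x (fun y => by linarith [hx y])
  have hL : Lop μ₁ μ₂ j₁ j₂ (fun y => -φ y) x
      = -Lop μ₁ μ₂ (fun p => j₁ (-p)) (fun p => j₂ (-p)) φ x := by
    simp only [Lop, hgrad, neg_add, ← integral_neg]
    congr 2 <;> ext z
    · rw [inner_neg_right]; ring
    · ring
  rw [hgrad, hL] at key
  simpa using key

lemma IsSuperSol.le_of_touching {N P : ℕ} {μ₁ μ₂ : Measure (RE P)} {j₁ j₂ : RE N → RE P → RE N}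
    {F : ℝ → RE N → ℝ → ℝ} {f u : RE N → ℝ} (hu : IsSuperSol μ₁ μ₂ j₁ j₂ F f u)
    [IsFiniteMeasure μ₂]
    (hj₁m : Measurable (Function.uncurry j₁)) (hj₂m : Measurable (Function.uncurry j₂))
    (hFc : Continuous fun t : ℝ × RE N × ℝ => F t.1 t.2.1 t.2.2)
    {y p : RE N} {g : RE N → ℝ} {C : ℝ} (hC : 0 ≤ C)
    (hj : Integrable (fun z => ‖j₁ p z‖ ^ 2) μ₁)
    (hgc : Continuous g) (hgb : Bdd g) (hg : ∀ j, |g j - ⟪j, p⟫_ℝ| ≤ C * ‖j‖ ^ 2)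
    (htouch : ∀ j, u y + g j ≤ u (y + j)) :
    f y ≤ F (u y) p (incOp μ₁ μ₂ j₁ j₂ g p) := by
  have hneg : Measurable fun t : RE N × RE P => (-t.1, t.2) :=
    measurable_fst.neg.prodMk measurable_snd
  have key := hu.neg_isSubSol.le_of_touching (y := y) (p := -p) (g := fun j => -g j)
    (hj₁m.comp hneg) (hj₂m.comp hneg)
    (hFc.comp (continuous_fst.neg.prodMk
      (continuous_snd.fst.neg.prodMk continuous_snd.snd.neg))).neg hC (by simpa using hj)
    hgc.neg (by
      obtain ⟨B, hB⟩ := hgb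
      exact ⟨B, fun y => by simpa using hB y⟩)
    (fun j => by
      rw [inner_neg_right, ← abs_neg]
      convert hg j using 2
      ring)
    (fun j => by linarith [htouch j])
  have hL : incOp μ₁ μ₂ (fun p => j₁ (-p)) (fun p => j₂ (-p)) (fun j => -g j) (-p)
      = -incOp μ₁ μ₂ j₁ j₂ g p := by
    simp only [incOp, neg_neg, neg_add, ← integral_neg]
    congr 2
    ext z
    rw [inner_neg_right]; ring
  rw [hL] at key
  simpa using key

lemma IsModulus.exists_pos_lt {ω : ℝ → ℝ} (hω : IsModulus ω) {κ : ℝ} (hκ : 0 < κ) :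
    ∃ δ > 0, ∀ s, 0 < s → s < δ → ω s < κ := by
  have h := hω.2.2.eventually (gt_mem_nhds hκ)
  obtain ⟨δ, hδ, hs⟩ := mem_nhdsGT_iff_exists_Ioo_subset.1 h
  exact ⟨δ, hδ, fun s h0 h1 => hs ⟨h0, h1⟩⟩

lemma eq_zero_of_inner_le_sq {N : ℕ} {v : RE N} {C : ℝ}
    (h : ∀ j : RE N, ⟪j, v⟫_ℝ ≤ C * ‖j‖ ^ 2) : v = 0 := by
  have hC : 0 < |C| + 1 := by positivity
  have h1 := h ((1 / (2 * (|C| + 1))) • v)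
  rw [real_inner_smul_left, real_inner_self_eq_norm_sq, norm_smul, mul_pow,
    Real.norm_of_nonneg (by positivity)] at h1
  set n := ‖v‖ ^ 2 with hn
  have hn0 : 0 ≤ n := by positivity
  have h2 : C * ((1 / (2 * (|C| + 1))) ^ 2 * n) ≤ (|C| + 1) * ((1 / (2 * (|C| + 1))) ^ 2 * n) := by
    gcongr
    linarith [le_abs_self C]
  have h3 : (|C| + 1) * ((1 / (2 * (|C| + 1))) ^ 2 * n) = (1 / (2 * (|C| + 1))) * n / 2 := by
    field_simp
  have h4 : (1 / (2 * (|C| + 1))) * n ≤ 0 := by linarith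
  have h5 : n ≤ 0 := by
    by_contra hcon
    push Not at hcon
    have : 0 < (1 / (2 * (|C| + 1))) * n := by positivity
    linarith
  have : ‖v‖ = 0 := by
    rw [hn] at h5
    exact pow_eq_zero_iff (two_ne_zero) |>.1 (le_antisymm h5 (by positivity))
  exact norm_eq_zero.1 this

/-- A semiconcave function which is quadratically bounded below at the origin has increments
controlled by the product of the distance to the origin and the length of the step. -/
lemma semiconcave_sub_le {N : ℕ} {G : RE N → ℝ} {C θ : ℝ} (hC : 0 < C) (hθ : 0 < θ)
    (hG : ∀ j, |G j| ≤ C * ‖j‖ ^ 2)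
    (hs : ∀ a, ∃ s : RE N, ∀ k, G (a + k) ≤ G a + ⟪k, s⟫_ℝ + C * ‖k‖ ^ 2) (a b : RE N) :
    G b - G a ≤ 6 * C * θ * ‖a‖ ^ 2 + (6 * C / (4 * θ) + C) * ‖b - a‖ ^ 2 := by
  obtain ⟨s, hs⟩ := hs a
  have hsa : ‖s‖ ≤ 6 * C * ‖a‖ := by
    have h1 := hs (-(1 / (6 * C)) • s)
    have h2 := (abs_le.1 (hG (a + -(1 / (6 * C)) • s))).1
    have h3 := (abs_le.1 (hG a)).2
    have h4 : ‖a + -(1 / (6 * C)) • s‖ ^ 2 ≤ 2 * ‖a‖ ^ 2 + 2 * ‖-(1 / (6 * C)) • s‖ ^ 2 := by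
      have := norm_add_le a (-(1 / (6 * C)) • s)
      nlinarith [sq_nonneg (‖a‖ - ‖-(1 / (6 * C)) • s‖), norm_nonneg (a + -(1 / (6 * C)) • s),
        norm_nonneg a, norm_nonneg (-(1 / (6 * C)) • s)]
    have h5 : ‖-(1 / (6 * C)) • s‖ ^ 2 = (1 / (6 * C)) ^ 2 * ‖s‖ ^ 2 := by
      rw [norm_smul, mul_pow, norm_neg, Real.norm_of_nonneg (by positivity)]
    rw [h5] at h4 h1
    rw [real_inner_smul_left, real_inner_self_eq_norm_sq] at h1
    have h6 : C * ‖a + -(1 / (6 * C)) • s‖ ^ 2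
        ≤ C * (2 * ‖a‖ ^ 2 + 2 * ((1 / (6 * C)) ^ 2 * ‖s‖ ^ 2)) := by gcongr
    have h7 : (1 / (6 * C)) * ‖s‖ ^ 2
        ≤ 3 * C * ‖a‖ ^ 2 + 3 * C * ((1 / (6 * C)) ^ 2 * ‖s‖ ^ 2) := by linarith
    have h8 : 3 * C * ((1 / (6 * C)) ^ 2 * ‖s‖ ^ 2) = (1 / (6 * C)) * ‖s‖ ^ 2 / 2 := by
      field_simp
      ring
    have h9 : (1 / (6 * C)) * ‖s‖ ^ 2 ≤ 6 * C * ‖a‖ ^ 2 := by linarith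
    have h10 : ‖s‖ ^ 2 ≤ (6 * C * ‖a‖) ^ 2 := by
      have := mul_le_mul_of_nonneg_left h9 (by positivity : 0 ≤ 6 * C)
      calc ‖s‖ ^ 2 = 6 * C * (1 / (6 * C) * ‖s‖ ^ 2) := by field_simp
        _ ≤ _ := this
        _ = _ := by ring
    exact le_of_sq_le_sq h10 (by positivity)
  have h1 := hs (b - a)
  rw [add_sub_cancel] at h1
  have h2 : ⟪b - a, s⟫_ℝ ≤ ‖b - a‖ * (6 * C * ‖a‖) :=
    (real_inner_le_norm _ _).trans (by gcongr)
  have h3 : ‖b - a‖ * ‖a‖ ≤ θ * ‖a‖ ^ 2 + ‖b - a‖ ^ 2 / (4 * θ) := by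
    have : 0 ≤ (2 * θ * ‖a‖ - ‖b - a‖) ^ 2 / (4 * θ) := by positivity
    have h4 : (2 * θ * ‖a‖ - ‖b - a‖) ^ 2 / (4 * θ)
        = θ * ‖a‖ ^ 2 + ‖b - a‖ ^ 2 / (4 * θ) - ‖b - a‖ * ‖a‖ := by
      field_simp
      ring
    linarith
  have h5 : ‖b - a‖ * (6 * C * ‖a‖) ≤ 6 * C * (θ * ‖a‖ ^ 2 + ‖b - a‖ ^ 2 / (4 * θ)) := by
    calc ‖b - a‖ * (6 * C * ‖a‖) = 6 * C * (‖b - a‖ * ‖a‖) := by ring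
      _ ≤ _ := by gcongr
  have h6 : 6 * C * (θ * ‖a‖ ^ 2 + ‖b - a‖ ^ 2 / (4 * θ)) + C * ‖b - a‖ ^ 2
      = 6 * C * θ * ‖a‖ ^ 2 + (6 * C / (4 * θ) + C) * ‖b - a‖ ^ 2 := by
    field_simp
    ring
  linarith

/-- Sup-convolution of a bounded continuous function: `A` is the sup-convolution, `Y x` a point
realizing the supremum at `x`. -/
lemma exists_supConvolution {N : ℕ} {u : RE N → ℝ} {M c : ℝ} (hc : 0 < c) (hu : Continuous u)
    (hM : ∀ x, |u x| ≤ M) :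
    ∃ (A : RE N → ℝ) (Y : RE N → RE N), Continuous A ∧ (∀ x, u x ≤ A x) ∧
      (∀ x, A x ≤ u (Y x)) ∧ (∀ x, ‖x - Y x‖ ≤ Real.sqrt (2 * M / c)) ∧
      (∀ x, ∃ s : RE N, ‖s‖ ≤ 2 * c * Real.sqrt (2 * M / c) ∧
        ∀ j, A x - ⟪j, s⟫_ℝ - c * ‖j‖ ^ 2 ≤ A (x + j)) ∧
      ∀ x j, A x + (u (Y x + j) - u (Y x)) ≤ A (x + j) := by
  have hM0 : 0 ≤ M := (abs_nonneg _).trans (hM 0)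
  set R := Real.sqrt (2 * M / c) with hR
  have hRsq : c * R ^ 2 = 2 * M := by
    rw [hR, Real.sq_sqrt (by positivity)]
    field_simp
  have hmax : ∀ x, ∃ y, ‖x - y‖ ≤ R ∧ ∀ y', u y' - c * ‖x - y'‖ ^ 2 ≤ u y - c * ‖x - y‖ ^ 2 := by
    intro x
    have hcont : Continuous fun y => u y - c * ‖x - y‖ ^ 2 := by fun_prop
    obtain ⟨y, hy, hymax⟩ := (isCompact_closedBall x R).exists_isMaxOn
      (nonempty_closedBall.2 (Real.sqrt_nonneg _)) hcont.continuousOn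
    refine ⟨y, by rw [← dist_eq_norm, dist_comm]; exact hy, fun y' => ?_⟩
    by_cases h : y' ∈ closedBall x R
    · exact hymax h
    · have h1 : R < ‖x - y'‖ := by
        rw [mem_closedBall, not_le, dist_comm, dist_eq_norm] at h
        exact h
      have h2 : R ^ 2 ≤ ‖x - y'‖ ^ 2 := pow_le_pow_left₀ (Real.sqrt_nonneg _) h1.le 2
      have h3 : c * R ^ 2 ≤ c * ‖x - y'‖ ^ 2 := by gcongr
      have h4 : u x - c * ‖x - x‖ ^ 2 ≤ u y - c * ‖x - y‖ ^ 2 :=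
        hymax (mem_closedBall_self (Real.sqrt_nonneg _))
      simp only [sub_self, norm_zero] at h4
      have := abs_le.1 (hM x)
      have := abs_le.1 (hM y')
      linarith
  choose Y hYR hY using hmax
  have hslope : ∀ x j, u (Y x) - c * ‖x - Y x‖ ^ 2 - ⟪j, (2 * c) • (x - Y x)⟫_ℝ - c * ‖j‖ ^ 2
      ≤ u (Y (x + j)) - c * ‖x + j - Y (x + j)‖ ^ 2 := fun x j => by
    refine le_trans (le_of_eq ?_) (hY (x + j) (Y x))
    have : x + j - Y x = (x - Y x) + j := by abel
    rw [this, norm_add_sq_real, real_inner_smul_right, real_inner_comm]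
    ring
  have hnorm : ∀ x, ‖(2 * c) • (x - Y x)‖ ≤ 2 * c * R := fun x => by
    rw [norm_smul, Real.norm_of_nonneg (by positivity)]
    have := hYR x
    gcongr
  refine ⟨fun x => u (Y x) - c * ‖x - Y x‖ ^ 2, Y, ?_, fun x => ?_, fun x => ?_, hYR,
    fun x => ⟨_, hnorm x, hslope x⟩, fun x j => ?_⟩
  · have hone : ∀ x y, (u (Y x) - c * ‖x - Y x‖ ^ 2) - (u (Y y) - c * ‖y - Y y‖ ^ 2)
        ≤ 2 * c * R * ‖y - x‖ + c * ‖y - x‖ ^ 2 := fun x y => by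
      have h1 := hslope x (y - x)
      rw [add_sub_cancel] at h1
      have h2 : ⟪y - x, (2 * c) • (x - Y x)⟫_ℝ ≤ ‖y - x‖ * (2 * c * R) :=
        (real_inner_le_norm _ _).trans (by have := hnorm x; gcongr)
      linarith
    refine continuous_iff_continuousAt.2 fun x => tendsto_iff_dist_tendsto_zero.2 ?_
    refine squeeze_zero (fun _ => dist_nonneg)
      (g := fun y => 2 * c * R * ‖y - x‖ + c * ‖y - x‖ ^ 2) (fun y => ?_) ?_
    · rw [Real.dist_eq, abs_le]
      have h1 := hone x y
      have h2 := hone y x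
      rw [norm_sub_rev x y] at h2
      constructor <;> linarith
    · have : Continuous fun y => 2 * c * R * ‖y - x‖ + c * ‖y - x‖ ^ 2 := by fun_prop
      simpa using this.tendsto x
  · simpa using hY x x
  · have : 0 ≤ c * ‖x - Y x‖ ^ 2 := by positivity
    simpa using this
  · have := hY (x + j) (Y x + j)
    rw [add_sub_add_right_eq_sub] at this
    simp only
    linarith

lemma exists_infConvolution {N : ℕ} {u : RE N → ℝ} {M c : ℝ} (hc : 0 < c) (hu : Continuous u)
    (hM : ∀ x, |u x| ≤ M) :
    ∃ (B : RE N → ℝ) (Y : RE N → RE N), Continuous B ∧ (∀ x, B x ≤ u x) ∧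
      (∀ x, u (Y x) ≤ B x) ∧ (∀ x, ‖x - Y x‖ ≤ Real.sqrt (2 * M / c)) ∧
      (∀ x, ∃ s : RE N, ‖s‖ ≤ 2 * c * Real.sqrt (2 * M / c) ∧
        ∀ j, B (x + j) ≤ B x + ⟪j, s⟫_ℝ + c * ‖j‖ ^ 2) ∧
      ∀ x j, B (x + j) ≤ B x + (u (Y x + j) - u (Y x)) := by
  obtain ⟨A, Y, hA, h1, h2, h3, h4, h5⟩ := exists_supConvolution hc hu.neg
    (fun x => by simpa using hM x)
  refine ⟨fun x => -A x, Y, hA.neg, fun x => by simpa using neg_le.1 (h1 x),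
    fun x => by simpa using le_neg.1 (h2 x), h3, fun x => ?_, fun x j => ?_⟩
  · obtain ⟨s, hs, h⟩ := h4 x
    exact ⟨s, hs, fun j => by linarith [h j]⟩
  · have := h5 x j
    simp only [Pi.neg_apply] at this
    linarith

/-- A bounded continuous function has, up to a small smooth bounded perturbation, a global
maximum point at which it is almost maximal. -/
lemma exists_penalized_max {N : ℕ} {w : RE N → ℝ} (hw : Continuous w) (hwb : Bdd w) {η : ℝ}
    (hη : 0 < η) :
    ∃ x a : RE N, ‖a‖ ≤ 1 ∧ (∀ y, w y ≤ w x + η) ∧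
      ∀ j, w (x + j) ≤ w x + η * (⟪j, a⟫_ℝ + ‖j‖ ^ 2) ∧ w (x + j) ≤ w x + η := by
  obtain ⟨K, hK⟩ := hwb
  have hbdd : BddAbove (Set.range w) := ⟨K, by rintro _ ⟨y, rfl⟩; exact (abs_le.1 (hK y)).2⟩
  obtain ⟨_, ⟨x₀, rfl⟩, hx₀⟩ := exists_lt_of_lt_csSup (Set.range_nonempty w)
    (by linarith : sSup (Set.range w) - η / 2 < sSup (Set.range w))
  have hx₀' : ∀ y, w y ≤ w x₀ + η / 2 := fun y => by
    linarith [le_csSup hbdd (Set.mem_range_self y)]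
  let ψ : RE N → ℝ := fun y => 1 - 1 / (1 + ‖y - x₀‖ ^ 2)
  have hψc : Continuous ψ := by
    refine continuous_const.sub (continuous_const.div (by fun_prop) fun y => ?_)
    positivity
  have hψ0 : ∀ y, 0 ≤ ψ y := fun y => by
    simp only [ψ, sub_nonneg]
    rw [div_le_one (by positivity)]
    linarith [sq_nonneg ‖y - x₀‖]
  have hψ1 : ∀ y, ψ y ≤ 1 := fun y => by
    have : 0 ≤ 1 / (1 + ‖y - x₀‖ ^ 2) := by positivity
    simp only [ψ]; linarith
  have hψx₀ : ψ x₀ = 0 := by simp [ψ]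
  obtain ⟨x, hxb, hxm⟩ := (isCompact_closedBall x₀ 1).exists_isMaxOn
    (nonempty_closedBall.2 zero_le_one) (hw.sub (hψc.const_mul η)).continuousOn
  have hx0 : w x₀ ≤ w x - η * ψ x := by
    have : w x₀ - η * ψ x₀ ≤ w x - η * ψ x := hxm (mem_closedBall_self zero_le_one)
    simpa [hψx₀] using this
  have hmax : ∀ y, w y - η * ψ y ≤ w x - η * ψ x := fun y => by
    by_cases h : y ∈ closedBall x₀ 1
    · exact hxm h
    · rw [mem_closedBall, not_le, dist_eq_norm] at h
      have h1 : 1 / 2 ≤ ψ y := by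
        have : 1 / (1 + ‖y - x₀‖ ^ 2) ≤ 1 / 2 := by
          apply one_div_le_one_div_of_le two_pos
          nlinarith
        simp only [ψ]; linarith
      have h2 : η * (1 / 2) ≤ η * ψ y := by gcongr
      linarith [hx₀' y]
  have hηψ : 0 ≤ η * ψ x := mul_nonneg hη.le (hψ0 x)
  set b := x - x₀ with hb
  have hs : 1 ≤ 1 + ‖b‖ ^ 2 := by linarith [sq_nonneg ‖b‖]
  refine ⟨x, (2 / (1 + ‖b‖ ^ 2) ^ 2) • b, ?_, fun y => by linarith [hx₀' y], fun j => ⟨?_, ?_⟩⟩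
  · rw [norm_smul, Real.norm_of_nonneg (by positivity), div_mul_eq_mul_div,
      div_le_one (by positivity)]
    nlinarith [sq_nonneg (‖b‖ - 1)]
  · have h1 := hmax (x + j)
    have h2 : ψ (x + j) - ψ x
        ≤ ⟪j, (2 / (1 + ‖b‖ ^ 2) ^ 2) • b⟫_ℝ + ‖j‖ ^ 2 := by
      have h3 : x + j - x₀ = b + j := by rw [hb]; abel
      simp only [ψ, h3, ← hb]
      rw [norm_add_sq_real, real_inner_smul_right, real_inner_comm]
      have ht : 0 < 1 + (‖b‖ ^ 2 + 2 * ⟪j, b⟫_ℝ + ‖j‖ ^ 2) := by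
        rw [real_inner_comm, ← norm_add_sq_real]
        positivity
      set s := 1 + ‖b‖ ^ 2
      set i := ⟪j, b⟫_ℝ
      have hts : 1 + (‖b‖ ^ 2 + 2 * i + ‖j‖ ^ 2) = s + 2 * i + ‖j‖ ^ 2 := by ring
      rw [hts] at ht ⊢
      set t := s + 2 * i + ‖j‖ ^ 2
      have hs0 : 0 < s := by linarith
      have h4 : 1 - 1 / t - (1 - 1 / s)
          = 2 / s ^ 2 * i + ‖j‖ ^ 2 / s ^ 2 - (t - s) ^ 2 / (s ^ 2 * t) := by
        have : 2 * i = t - s - ‖j‖ ^ 2 := by simp only [t]; ring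
        field_simp
        linear_combination (-t) * this
      have h5 : 0 ≤ (t - s) ^ 2 / (s ^ 2 * t) := by positivity
      have h6 : ‖j‖ ^ 2 / s ^ 2 ≤ ‖j‖ ^ 2 := div_le_self (by positivity) (by nlinarith)
      linarith
    have h3 : η * (ψ (x + j) - ψ x)
        ≤ η * (⟪j, (2 / (1 + ‖b‖ ^ 2) ^ 2) • b⟫_ℝ + ‖j‖ ^ 2) := by gcongr
    linarith
  · have := hx₀' (x + j)
    linarith

lemma abs_incOp_le {N P : ℕ} {μ₁ μ₂ : Measure (RE P)} [IsFiniteMeasure μ₂]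
    {j₁ j₂ : RE N → RE P → RE N} {g : RE N → ℝ} {p : RE N} {B C D : ℝ} (hC : 0 ≤ C)
    (hj : Integrable (fun z => ‖j₁ p z‖ ^ 2) μ₁) (hjD : ∫ z, ‖j₁ p z‖ ^ 2 ∂μ₁ ≤ D)
    (hgb : ∀ j, |g j| ≤ B) (hg : ∀ j, |g j - ⟪j, p⟫_ℝ| ≤ C * ‖j‖ ^ 2) :
    |incOp μ₁ μ₂ j₁ j₂ g p| ≤ C * D + B * μ₂.real Set.univ := by
  refine (abs_add_le _ _).trans (add_le_add ?_ ?_)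
  · refine (norm_integral_le_of_norm_le (f := fun z => g (j₁ p z) - ⟪j₁ p z, p⟫_ℝ)
      (hj.const_mul C)
      (Eventually.of_forall fun z => hg _)).trans ?_
    rw [integral_const_mul]
    gcongr
  · exact norm_integral_le_of_norm_le_const (f := fun z => g (j₂ p z))
      (Eventually.of_forall fun z => hgb _)

/-- For jumps continuous in the gradient variable, bounded costs of the displacement
`j p z - j q z` have small average, locally uniformly in `p` and `q`. -/
lemma exists_integral_cost_le {N P : ℕ} {μ : Measure (RE P)} [IsFiniteMeasure μ]
    {j : RE N → RE P → RE N} (hjm : Measurable (Function.uncurry j))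
    (hjc : ∀ᵐ z ∂μ, Continuous fun p => j p z) {m : ℝ → ℝ} {B : ℝ} (hm : Continuous m)
    (hm0 : m 0 = 0) (hmB : ∀ t, |m t| ≤ B) (R : ℝ) {κ : ℝ} (hκ : 0 < κ) :
    ∃ δ > 0, ∀ p q : RE N, ‖p‖ ≤ R → ‖q‖ ≤ R → ‖p - q‖ < δ →
      ∫ z, m ‖j p z - j q z‖ ∂μ < κ := by
  have hcont : Continuous fun t : RE N × RE N => ∫ z, m ‖j t.1 z - j t.2 z‖ ∂μ := by
    refine continuous_of_dominated (bound := fun _ => B) (fun t => ?_)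
      (fun t => Eventually.of_forall fun z => hmB _) (integrable_const _) ?_
    · exact (hm.measurable.comp (((hjm.comp measurable_prodMk_left).sub
        (hjm.comp measurable_prodMk_left)).norm)).aestronglyMeasurable
    · filter_upwards [hjc] with z hz
      exact hm.comp ((hz.comp continuous_fst).sub (hz.comp continuous_snd)).norm
  have huc := ((isCompact_closedBall (0 : RE N) R).prod
    (isCompact_closedBall (0 : RE N) R)).uniformContinuousOn_of_continuous hcont.continuousOn
  obtain ⟨δ, hδ, h⟩ := Metric.uniformContinuousOn_iff.1 huc κ hκ
  refine ⟨δ, hδ, fun p q hp hq hpq => ?_⟩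
  have hp' : p ∈ closedBall (0 : RE N) R := by simpa using hp
  have hq' : q ∈ closedBall (0 : RE N) R := by simpa using hq
  have := h (p, q) ⟨hp', hq'⟩ (q, q) ⟨hq', hq'⟩ (by
    rw [Prod.dist_eq, dist_self, max_eq_left dist_nonneg, dist_eq_norm]
    exact hpq)
  simp only [sub_self, norm_zero, hm0, integral_zero, Real.dist_eq, sub_zero] at this
  exact (le_abs_self _).trans_lt this

/-- At an almost-maximum point of the difference of a semiconvex and a semiconcave function, the
nonlocal operators are almost ordered, uniformly in the functions. -/
lemma eventually_incOp_le {N P : ℕ} {μ₁ μ₂ : Measure (RE P)} [IsFiniteMeasure μ₂]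
    {j₁ j₂ : RE N → RE P → RE N}
    (hj₁m : Measurable (Function.uncurry j₁)) (hj₂m : Measurable (Function.uncurry j₂))
    (hj₂c : ∀ᵐ z ∂μ₂, Continuous fun p => j₂ p z)
    {R B C D : ℝ} {ω : ℝ → ℝ} (hC : 0 < C) (hD : 0 < D) (hB : 0 ≤ B) (hω : IsModulus ω)
    (hJ1 : ∀ p : RE N, ‖p‖ < R → (∫⁻ z, (‖j₁ p z‖₊ : ℝ≥0∞) ^ 2 ∂μ₁) ≤ ENNReal.ofReal D)
    (hJ2 : ∀ p q : RE N, ‖p‖ < R → ‖q‖ < R →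
      (∫⁻ z, (‖j₁ p z - j₁ q z‖₊ : ℝ≥0∞) ^ 2 ∂μ₁) ≤ ENNReal.ofReal (ω ‖p - q‖))
    {τ : ℝ} (hτ : 0 < τ) :
    ∀ᶠ η in 𝓝[>] (0 : ℝ), ∀ (p q a : RE N) (g₁ g₂ : RE N → ℝ), ‖p‖ < R → ‖q‖ < R → ‖a‖ ≤ 1 →
      p = q + η • a → Continuous g₁ → Continuous g₂ → (∀ j, |g₁ j| ≤ B) → (∀ j, |g₂ j| ≤ B) →
      (∀ j, |g₁ j - ⟪j, p⟫_ℝ| ≤ C * ‖j‖ ^ 2) → (∀ j, |g₂ j - ⟪j, q⟫_ℝ| ≤ C * ‖j‖ ^ 2) →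
      (∀ b, ∃ s : RE N, ‖s‖ ≤ R ∧ ∀ k, g₂ (b + k) ≤ g₂ b + ⟪k, s⟫_ℝ + C * ‖k‖ ^ 2) →
      (∀ j, g₁ j ≤ g₂ j + η * (⟪j, a⟫_ℝ + ‖j‖ ^ 2) ∧ g₁ j ≤ g₂ j + η) →
      incOp μ₁ μ₂ j₁ j₂ g₁ p ≤ incOp μ₁ μ₂ j₁ j₂ g₂ q + τ := by
  set V := μ₂.real Set.univ
  have hV0 : 0 ≤ V := measureReal_nonneg
  set θ := τ / (48 * C * D) with hθdef
  have hθ : 0 < θ := by positivity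
  set E := 6 * C / (4 * θ) + C
  have hE0 : 0 < E := by positivity
  set κ := τ / (8 * E) with hκdef
  have hκ : 0 < κ := by positivity
  obtain ⟨δ₁, hδ₁, hω₁⟩ := hω.exists_pos_lt hκ
  let m : ℝ → ℝ := fun t => min (2 * B) (R * |t| + C * t ^ 2)
  by_cases hR : R ≤ 0
  · refine Eventually.of_forall fun η p q a g₁ g₂ hp => ?_
    linarith [norm_nonneg p]
  push Not at hR
  have hm0 : ∀ t, 0 ≤ m t := fun t => le_min (by positivity) (by positivity)
  obtain ⟨δ₂, hδ₂, hm₂⟩ := exists_integral_cost_le (m := m) (B := 2 * B) hj₂m hj₂c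
    (by fun_prop) (by simp [m, hB])
    (fun t => by rw [abs_of_nonneg (hm0 t)]; exact min_le_left _ _) R (κ := τ / 4) (by positivity)
  have hmeas : ∀ {j : RE N → RE P → RE N} (p : RE N), Measurable (Function.uncurry j) →
      Measurable (j p) := fun p h => h.comp measurable_prodMk_left
  have e1 : ∀ᶠ η in 𝓝[>] (0 : ℝ), η < min (min δ₁ δ₂) (min (τ / (8 * D)) (τ / (8 * (V + 1)))) :=
    (gt_mem_nhds (by positivity)).filter_mono nhdsWithin_le_nhds
  filter_upwards [e1, self_mem_nhdsWithin] with η hη hη0 p q a g₁ g₂ hp hq ha hpq hg₁c hg₂c hg₁B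
    hg₂B hg₁ hg₂ hsc hle
  rw [Set.mem_Ioi] at hη0
  simp only [lt_min_iff] at hη
  obtain ⟨⟨hη1, hη2⟩, hη3, hη4⟩ := hη
  have hpqn : ‖p - q‖ ≤ η := by
    rw [hpq, add_sub_cancel_left, norm_smul, Real.norm_of_nonneg hη0.le]
    nlinarith
  obtain ⟨ip, hip⟩ := integrable_norm_sq_and_integral_le (hmeas p hj₁m) hD.le (hJ1 p hp)
  obtain ⟨iq, hiq⟩ := integrable_norm_sq_and_integral_le (hmeas q hj₁m) hD.le (hJ1 q hq)
  obtain ⟨ipq, hipq⟩ : Integrable (fun z => ‖j₁ p z - j₁ q z‖ ^ 2) μ₁ ∧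
      ∫ z, ‖j₁ p z - j₁ q z‖ ^ 2 ∂μ₁ ≤ κ := by
    by_cases h : p = q
    · simp [h, hκ.le]
    · refine integrable_norm_sq_and_integral_le ((hmeas p hj₁m).sub (hmeas q hj₁m)) hκ.le
        ((hJ2 p q hp hq).trans (ENNReal.ofReal_le_ofReal (hω₁ _ ?_ (hpqn.trans_lt hη1)).le))
      rwa [norm_pos_iff, sub_ne_zero]
  have hg_int : ∀ (g : RE N → ℝ) (r : RE N), Continuous g → (∀ j, |g j - ⟪j, r⟫_ℝ| ≤ C * ‖j‖ ^ 2) →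
      Integrable (fun z => ‖j₁ r z‖ ^ 2) μ₁ →
      Integrable (fun z => g (j₁ r z) - ⟪j₁ r z, r⟫_ℝ) μ₁ := fun g r hgc hg hi =>
    (hi.const_mul C).mono' ((hgc.measurable.comp (hmeas r hj₁m)).sub
      ((hmeas r hj₁m).inner measurable_const)).aestronglyMeasurable
      (Eventually.of_forall fun z => hg _)
  have hg_int₂ : ∀ (g : RE N → ℝ) (r : RE N), Continuous g → (∀ j, |g j| ≤ B) →
      Integrable (fun z => g (j₂ r z)) μ₂ := fun g r hgc hg =>
    (integrable_const B).mono' (hgc.measurable.comp (hmeas r hj₂m)).aestronglyMeasurable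
      (Eventually.of_forall fun z => hg _)
  have part₁ : ∫ z, (g₁ (j₁ p z) - ⟪j₁ p z, p⟫_ℝ) ∂μ₁
      ≤ ∫ z, (g₂ (j₁ q z) - ⟪j₁ q z, q⟫_ℝ) ∂μ₁ + 3 * τ / 8 := by
    have hpt : ∀ z, g₁ (j₁ p z) - ⟪j₁ p z, p⟫_ℝ ≤ (g₂ (j₁ q z) - ⟪j₁ q z, q⟫_ℝ)
        + (η * ‖j₁ p z‖ ^ 2 + (6 * C * θ * ‖j₁ q z‖ ^ 2 + E * ‖j₁ p z - j₁ q z‖ ^ 2)) := by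
      intro z
      have h1 := (hle (j₁ p z)).1
      have h2 := semiconcave_sub_le (G := fun j => g₂ j - ⟪j, q⟫_ℝ) hC hθ hg₂
        (fun b => by
          obtain ⟨s, -, hs⟩ := hsc b
          refine ⟨s - q, fun k => ?_⟩
          simp only [inner_add_left, inner_sub_right]
          linarith [hs k]) (j₁ q z) (j₁ p z)
      have h3 : ⟪j₁ p z, p⟫_ℝ = ⟪j₁ p z, q⟫_ℝ + η * ⟪j₁ p z, a⟫_ℝ := by
        rw [hpq, inner_add_right, real_inner_smul_right]
      rw [h3]
      linarith
    have iqs : Integrable (fun z => 6 * C * θ * ‖j₁ q z‖ ^ 2 + E * ‖j₁ p z - j₁ q z‖ ^ 2) μ₁ :=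
      (iq.const_mul _).add (ipq.const_mul _)
    have ir : Integrable (fun z => η * ‖j₁ p z‖ ^ 2
        + (6 * C * θ * ‖j₁ q z‖ ^ 2 + E * ‖j₁ p z - j₁ q z‖ ^ 2)) μ₁ := (ip.const_mul η).add iqs
    have h1 := integral_mono (hg_int g₁ p hg₁c hg₁ ip) ((hg_int g₂ q hg₂c hg₂ iq).add ir) hpt
    rw [integral_add' (hg_int g₂ q hg₂c hg₂ iq) ir, integral_add (ip.const_mul η) iqs,
      integral_add (iq.const_mul (6 * C * θ))
      (ipq.const_mul E), integral_const_mul, integral_const_mul, integral_const_mul] at h1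
    have h2 : η * ∫ z, ‖j₁ p z‖ ^ 2 ∂μ₁ ≤ τ / (8 * D) * D := by gcongr
    have h3 : 6 * C * θ * ∫ z, ‖j₁ q z‖ ^ 2 ∂μ₁ ≤ 6 * C * θ * D := by gcongr
    have h4 : E * ∫ z, ‖j₁ p z - j₁ q z‖ ^ 2 ∂μ₁ ≤ E * κ := by gcongr
    have h5 : τ / (8 * D) * D = τ / 8 := by field_simp
    have h6 : 6 * C * θ * D = τ / 8 := by rw [hθdef]; field_simp; norm_num
    have h7 : E * κ = τ / 8 := by rw [hκdef]; field_simp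
    linarith
  have part₂ : ∫ z, g₁ (j₂ p z) ∂μ₂ ≤ ∫ z, g₂ (j₂ q z) ∂μ₂ + 3 * τ / 8 := by
    have hpt : ∀ z, g₁ (j₂ p z) ≤ g₂ (j₂ q z) + (η + m ‖j₂ p z - j₂ q z‖) := by
      intro z
      have h1 := (hle (j₂ p z)).2
      have h2 : g₂ (j₂ p z) - g₂ (j₂ q z) ≤ m ‖j₂ p z - j₂ q z‖ := by
        refine le_min ?_ ?_
        · linarith [(abs_le.1 (hg₂B (j₂ p z))).2, (abs_le.1 (hg₂B (j₂ q z))).1]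
        · obtain ⟨s, hsR, hs⟩ := hsc (j₂ q z)
          have h3 := hs (j₂ p z - j₂ q z)
          rw [add_sub_cancel] at h3
          have h4 : ⟪j₂ p z - j₂ q z, s⟫_ℝ ≤ ‖j₂ p z - j₂ q z‖ * R :=
            (real_inner_le_norm _ _).trans (by gcongr)
          rw [abs_norm]
          linarith
      linarith
    have im : Integrable (fun z => m ‖j₂ p z - j₂ q z‖) μ₂ :=
      (integrable_const (2 * B)).mono' ((by fun_prop : Continuous m).measurable.comp
        (((hmeas p hj₂m).sub (hmeas q hj₂m)).norm)).aestronglyMeasurable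
        (Eventually.of_forall fun z => by
          rw [Real.norm_of_nonneg (hm0 _)]; exact min_le_left _ _)
    have ir : Integrable (fun z => η + m ‖j₂ p z - j₂ q z‖) μ₂ := (integrable_const η).add im
    have h1 := integral_mono (hg_int₂ g₁ p hg₁c hg₁B) ((hg_int₂ g₂ q hg₂c hg₂B).add ir) hpt
    rw [integral_add' (hg_int₂ g₂ q hg₂c hg₂B) ir,
      integral_add (integrable_const η) im, integral_const, smul_eq_mul] at h1
    have h2 := hm₂ p q hp.le hq.le (hpqn.trans_lt hη2)
    have h3 : V * η ≤ τ / 8 := by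
      calc V * η ≤ (V + 1) * (τ / (8 * (V + 1))) := by gcongr; linarith
        _ = _ := by field_simp
    linarith
  simp only [incOp]
  linarith

/-- Comparison of a subsolution `u` with the translate by `h` of a supersolution `v`. -/
lemma sub_translate_le {N P : ℕ} {μ₁ μ₂ : Measure (RE P)} [IsFiniteMeasure μ₂]
    {j₁ j₂ : RE N → RE P → RE N} {F : ℝ → RE N → ℝ → ℝ} {f u v : RE N → ℝ}
    (hj₁m : Measurable (Function.uncurry j₁)) (hj₂m : Measurable (Function.uncurry j₂))
    (hj₂c : ∀ᵐ z ∂μ₂, Continuous fun p => j₂ p z)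
    (hJ1 : ∀ r > 0, ∃ C > 0, ∀ p : RE N, ‖p‖ < r →
      (∫⁻ z, (‖j₁ p z‖₊ : ℝ≥0∞) ^ 2 ∂μ₁) ≤ ENNReal.ofReal C)
    (hJ2 : ∀ r > 0, ∃ ω : ℝ → ℝ, IsModulus ω ∧ ∀ p q : RE N, ‖p‖ < r → ‖q‖ < r →
      (∫⁻ z, (‖j₁ p z - j₁ q z‖₊ : ℝ≥0∞) ^ 2 ∂μ₁) ≤ ENNReal.ofReal (ω ‖p - q‖))
    (hF1c : Continuous fun t : ℝ × RE N × ℝ => F t.1 t.2.1 t.2.2)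
    (hF1m : ∀ (r : ℝ) (p : RE N) (l l' : ℝ), l ≤ l' → F r p l' ≤ F r p l)
    (hF3 : ∀ M > 0, ∀ r > 0, ∃ ω : ℝ → ℝ, IsModulus ω ∧
      ∀ (a : ℝ) (p q : RE N) (l l' : ℝ), |a| ≤ M → ‖p‖ ≤ r → ‖q‖ ≤ r → |l| ≤ r → |l'| ≤ r →
        |F a p l - F a q l'| ≤ ω (‖p - q‖ + |l - l'|))
    (huc : Continuous u) (hvc : Continuous v)
    (husub : IsSubSol μ₁ μ₂ j₁ j₂ F f u) (hvsuper : IsSuperSol μ₁ μ₂ j₁ j₂ F f v)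
    {M γ : ℝ} (hMu : ∀ x, |u x| ≤ M) (hMv : ∀ x, |v x| ≤ M) (hγ : 0 < γ)
    (hγF2 : ∀ (a b : ℝ) (p : RE N) (l : ℝ),
      -M ≤ b → b ≤ a → a ≤ M → γ * (a - b) ≤ F a p l - F b p l)
    {c D : ℝ} (hc : 0 < c) (hD : 0 ≤ D) (h : RE N)
    (hfD : ∀ y₁ y₂ : RE N, ‖y₁ - y₂‖ ≤ 2 * Real.sqrt (2 * M / c) → f y₁ - f (y₂ + h) ≤ D)
    (x : RE N) : γ * (u x - v (x + h)) ≤ D := by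
  have hM0 : 0 ≤ M := (abs_nonneg _).trans (hMu 0)
  obtain ⟨A, Y₁, hAc, hA1, hA2, hA3, hA4, hA5⟩ := exists_supConvolution hc huc hMu
  obtain ⟨B, Y₂, hBc, hB1, hB2, hB3, hB4, hB5⟩ := exists_infConvolution (u := fun x => v (x + h))
    hc (hvc.comp (continuous_id.add continuous_const)) (fun x => hMv _)
  set Q := 2 * c * Real.sqrt (2 * M / c)
  have hQ0 : 0 ≤ Q := by positivity
  have hAM : ∀ x, |A x| ≤ M := fun x => abs_le.2
    ⟨(abs_le.1 (hMu x)).1.trans (hA1 x), (hA2 x).trans (abs_le.1 (hMu _)).2⟩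
  have hBM : ∀ x, |B x| ≤ M := fun x => abs_le.2
    ⟨(abs_le.1 (hMv _)).1.trans (hB2 x), (hB1 x).trans (abs_le.1 (hMv _)).2⟩
  obtain ⟨D₁, hD₁, hJ1⟩ := hJ1 (Q + 2) (by positivity)
  obtain ⟨ω, hω, hJ2⟩ := hJ2 (Q + 2) (by positivity)
  set r := Q + 2 + ((c + 1) * D₁ + 2 * M * μ₂.real Set.univ)
  have hV : 0 ≤ 2 * M * μ₂.real Set.univ := by positivity
  have hCD : 0 ≤ (c + 1) * D₁ := by positivity
  obtain ⟨ω', hω', hF3⟩ := hF3 (M + 1) (by positivity) r (by positivity)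
  refine le_of_forall_pos_le_add fun σ hσ => ?_
  obtain ⟨δ, hδ, hωδ⟩ := hω'.exists_pos_lt (half_pos hσ)
  set τ := min 1 (δ / 2)
  have hτ : 0 < τ := by positivity
  have e1 := eventually_incOp_le hj₁m hj₂m hj₂c (R := Q + 2) (B := 2 * M) (C := c + 1)
    (by positivity) hD₁ (by positivity) hω hJ1 hJ2 hτ
  have e2 : ∀ᶠ η in 𝓝[>] (0 : ℝ), η < min (min 1 (δ / 2)) (σ / (2 * γ)) :=
    (gt_mem_nhds (by positivity)).filter_mono nhdsWithin_le_nhds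
  obtain ⟨η, ⟨hinc, hη⟩, hη0⟩ := ((e1.and e2).and self_mem_nhdsWithin).exists
  simp only [lt_min_iff] at hη
  obtain ⟨⟨hη1, hηδ⟩, hησ⟩ := hη
  have hησ' : γ * η ≤ σ / 2 := by
    calc γ * η ≤ γ * (σ / (2 * γ)) := by gcongr
      _ = σ / 2 := by field_simp
  obtain ⟨xm, a, ha, hmax, htouch⟩ := exists_penalized_max (w := fun x => A x - B x)
    (hAc.sub hBc) ⟨2 * M, fun x => by
      have := abs_le.1 (hAM x)
      have := abs_le.1 (hBM x)
      exact abs_le.2 ⟨by linarith, by linarith⟩⟩ hη0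
  have hdiff : u x - v (x + h) ≤ u (Y₁ xm) - v (Y₂ xm + h) + η := by
    have := hmax x
    linarith [hA1 x, hB1 x, hA2 xm, hB2 xm]
  by_cases hneg : u (Y₁ xm) ≤ v (Y₂ xm + h)
  · have : γ * (u x - v (x + h)) ≤ γ * η := by gcongr; linarith
    linarith
  push Not at hneg
  obtain ⟨s₁, hs₁n, hs₁⟩ := hA4 xm
  obtain ⟨q, hqn, hq⟩ := hB4 xm
  set g₁ : RE N → ℝ := fun j => A (xm + j) - A xm with hg₁def
  set g₂ : RE N → ℝ := fun j => B (xm + j) - B xm with hg₂def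
  have hle : ∀ j, g₁ j ≤ g₂ j + η * (⟪j, a⟫_ℝ + ‖j‖ ^ 2) ∧ g₁ j ≤ g₂ j + η := fun j => by
    have := htouch j
    simp only [hg₁def, hg₂def]
    constructor <;> linarith [this.1, this.2]
  have hgrad : -s₁ = q + η • a := by
    have := eq_zero_of_inner_le_sq (v := -s₁ - (q + η • a)) (C := 2 * c + η) (fun j => by
      have h1 := (hle j).1
      have h2 := hs₁ j
      have h3 := hq j
      simp only [hg₁def, hg₂def] at h1
      rw [inner_sub_right, inner_neg_right, inner_add_right, real_inner_smul_right]
      linarith)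
    exact sub_eq_zero.1 this
  set p := -s₁ with hp
  have hpn : ‖p‖ ≤ Q := by rwa [hp, norm_neg]
  have hg : ∀ j, |g₁ j - ⟪j, p⟫_ℝ| ≤ (c + 1) * ‖j‖ ^ 2 ∧
      |g₂ j - ⟪j, q⟫_ℝ| ≤ (c + 1) * ‖j‖ ^ 2 := fun j => by
    have h0 : 0 ≤ ‖j‖ ^ 2 := by positivity
    have h1 := (hle j).1
    have h2 := hs₁ j
    have h3 := hq j
    have h4 : ⟪j, p⟫_ℝ = ⟪j, q⟫_ℝ + η * ⟪j, a⟫_ℝ := by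
      rw [hgrad, inner_add_right, real_inner_smul_right]
    have h5 : ⟪j, p⟫_ℝ = -⟪j, s₁⟫_ℝ := by rw [hp, inner_neg_right]
    have h6 : η * ‖j‖ ^ 2 ≤ ‖j‖ ^ 2 := mul_le_of_le_one_left h0 hη1.le
    simp only [hg₁def, hg₂def] at h1 ⊢
    exact ⟨abs_le.2 ⟨by linarith, by linarith⟩, abs_le.2 ⟨by linarith, by linarith⟩⟩
  have hg₁ := fun j => (hg j).1
  have hg₂ := fun j => (hg j).2
  have hg₁c : Continuous g₁ := by fun_prop
  have hg₂c : Continuous g₂ := by fun_prop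
  have hinc_bdd : ∀ w : RE N → ℝ, (∀ x, |w x| ≤ M) → ∀ j, |w (xm + j) - w xm| ≤ 2 * M :=
    fun w hw j => (abs_sub _ _).trans (by linarith [hw (xm + j), hw xm])
  have hg₁B : ∀ j, |g₁ j| ≤ 2 * M := hinc_bdd A hAM
  have hg₂B : ∀ j, |g₂ j| ≤ 2 * M := hinc_bdd B hBM
  have hpR : ‖p‖ < Q + 2 := by linarith
  have hqR : ‖q‖ < Q + 2 := by linarith
  have hI := hinc p q a g₁ g₂ hpR hqR ha hgrad hg₁c hg₂c hg₁B hg₂B hg₁ hg₂ (fun b => by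
    obtain ⟨s, hs, hs'⟩ := hB4 (xm + b)
    refine ⟨s, by linarith, fun k => ?_⟩
    have := hs' k
    rw [add_assoc] at this
    have h0 : 0 ≤ ‖k‖ ^ 2 := by positivity
    simp only [hg₂def]
    linarith) hle
  have hmeas : ∀ r : RE N, Measurable (j₁ r) := fun r => hj₁m.comp measurable_prodMk_left
  obtain ⟨ip, -⟩ := integrable_norm_sq_and_integral_le (hmeas p) hD₁.le (hJ1 p hpR)
  obtain ⟨iq, hiq⟩ := integrable_norm_sq_and_integral_le (hmeas q) hD₁.le (hJ1 q hqR)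
  have hsub := husub.le_of_touching hj₁m hj₂m hF1c (y := Y₁ xm) (by positivity) ip hg₁c
    ⟨_, hg₁B⟩ hg₁ (fun j => by linarith [hA5 xm j])
  have hsup := hvsuper.le_of_touching hj₁m hj₂m hF1c (y := Y₂ xm + h) (by positivity) iq hg₂c
    ⟨_, hg₂B⟩ hg₂ (fun j => by
      have := hB5 xm j
      rw [add_right_comm] at this
      linarith)
  set I₁ := incOp μ₁ μ₂ j₁ j₂ g₁ p
  set I₂ := incOp μ₁ μ₂ j₁ j₂ g₂ q
  have hI₂b : |I₂| ≤ (c + 1) * D₁ + 2 * M * μ₂.real Set.univ :=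
    abs_incOp_le (by positivity) iq hiq hg₂B hg₂
  have hτ1 : τ ≤ 1 := min_le_left _ _
  have hτδ : τ ≤ δ / 2 := min_le_right _ _
  have hpq : ‖p - q‖ ≤ η := by
    rw [hgrad, add_sub_cancel_left, norm_smul, Real.norm_of_nonneg hη0.le]
    nlinarith
  have h1 := hγF2 (u (Y₁ xm)) (v (Y₂ xm + h)) p I₁ (abs_le.1 (hMv _)).1 hneg.le
    (abs_le.1 (hMu _)).2
  have h2 := hF1m (v (Y₂ xm + h)) p _ _ hI
  have h3 := hF3 (v (Y₂ xm + h)) p q (I₂ + τ) I₂ ((hMv _).trans (by linarith)) (by linarith)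
    (by linarith) (by
      refine (abs_add_le _ _).trans ?_
      rw [abs_of_pos hτ]
      linarith) (by linarith)
  rw [add_sub_cancel_left, abs_of_pos hτ] at h3
  have h4 := hωδ (‖p - q‖ + τ) (by positivity) (by linarith)
  have h5 := hfD (Y₁ xm) (Y₂ xm) (by
    have := norm_sub_le_norm_sub_add_norm_sub (Y₁ xm) xm (Y₂ xm)
    rw [norm_sub_rev (Y₁ xm) xm] at this
    linarith [hA3 xm, hB3 xm])
  have h6 : γ * (u x - v (x + h)) ≤ γ * (u (Y₁ xm) - v (Y₂ xm + h) + η) := by gcongr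
  rw [mul_add] at h6
  linarith [(abs_le.1 h3).1]

lemma bddAbove_modCont {N : ℕ} {f : RE N → ℝ} (hf : UniformContinuous f) (h : ℝ) :
    BddAbove {d : ℝ | ∃ x y : RE N, ‖y‖ < h ∧ d = |f (x + y) - f x|} := by
  obtain ⟨δ, hδ, hfδ⟩ := Metric.uniformContinuous_iff.1 hf 1 one_pos
  have key : ∀ (n : ℕ) (x y : RE N), ‖y‖ < (n + 1) * δ → |f (x + y) - f x| ≤ n + 1 := by
    intro n
    induction n with
    | zero =>
      intro x y hy
      have := hfδ (a := x + y) (b := x) (by simpa using hy)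
      simpa [Real.dist_eq] using this.le
    | succ n ih =>
      intro x y hy
      have hn : (0 : ℝ) < n + 1 + 1 := by positivity
      push_cast at hy ⊢
      set t : ℝ := 1 / ((n : ℝ) + 1 + 1) with ht
      have ht0 : 0 < t := by positivity
      have hty : ‖t • y‖ < δ := by
        rw [norm_smul, Real.norm_of_nonneg ht0.le, ht, one_div, inv_mul_lt_iff₀ hn]
        exact hy
      have hty' : ‖(1 - t) • y‖ < (n + 1) * δ := by
        have h1 : 1 - t = (n + 1) * t := by rw [ht]; field_simp; ring
        rw [h1, mul_smul, norm_smul, Real.norm_of_nonneg (by positivity)]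
        gcongr
      have h1 := ih (x + t • y) _ hty'
      have h2 : x + t • y + (1 - t) • y = x + y := by
        rw [add_assoc, ← add_smul, add_sub_cancel, one_smul]
      rw [h2] at h1
      have h3 := hfδ (a := x + t • y) (b := x) (by simpa using hty)
      rw [Real.dist_eq] at h3
      have h4 := abs_sub_le (f (x + y)) (f (x + t • y)) (f x)
      linarith
  obtain ⟨n, hn⟩ := exists_nat_gt (h / δ)
  refine ⟨n + 1, ?_⟩
  rintro _ ⟨x, y, hy, rfl⟩
  refine key n x y (hy.trans ?_)
  rw [div_lt_iff₀ hδ] at hn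
  linarith

/-- Uniform continuity with modulus bound: any bounded continuous viscosity solution `u`
of `F(u, Du, L[u,Du]) = f` is uniformly continuous and satisfies `γ_M · ω_u(h) ≤ ω_f(h)`
where `M` bounds `‖u‖_∞` and `γ_M` is the constant of (F2) for this `M`. -/
theorem uniform_continuity_of_solution
    (N P : ℕ) (hN : 1 ≤ N) (hP : 1 ≤ P)
    (μ₁ μ₂ : Measure (RE P)) (j₁ j₂ : RE N → RE P → RE N)
    (F : ℝ → RE N → ℝ → ℝ) (f u : RE N → ℝ)
    -- (M)
    (hM0 : μ₁ {0} = 0) (hM0' : μ₂ {0} = 0)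
    (hM1 : (∫⁻ z, (‖z‖₊ : ℝ≥0∞) ^ 2 ∂μ₁) < ⊤)
    (hM2 : μ₂ Set.univ < ⊤)
    -- j measurable and continuous in p for a.e. z
    (hj₁m : Measurable (Function.uncurry j₁))
    (hj₂m : Measurable (Function.uncurry j₂))
    (hj₁c : ∀ᵐ z ∂μ₁, Continuous fun p => j₁ p z)
    (hj₂c : ∀ᵐ z ∂μ₂, Continuous fun p => j₂ p z)
    -- (J1)
    (hJ1 : ∀ r > 0, ∃ C > 0, ∀ p : RE N, ‖p‖ < r →
      (∫⁻ z, (‖j₁ p z‖₊ : ℝ≥0∞) ^ 2 ∂μ₁) ≤ ENNReal.ofReal C)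
    -- (J2)
    (hJ2 : ∀ r > 0, ∃ ω : ℝ → ℝ, IsModulus ω ∧ ∀ p q : RE N, ‖p‖ < r → ‖q‖ < r →
      (∫⁻ z, (‖j₁ p z - j₁ q z‖₊ : ℝ≥0∞) ^ 2 ∂μ₁) ≤ ENNReal.ofReal (ω ‖p - q‖))
    -- (F1)
    (hF1c : Continuous fun t : ℝ × RE N × ℝ => F t.1 t.2.1 t.2.2)
    (hF1m : ∀ (r : ℝ) (p : RE N) (l l' : ℝ), l ≤ l' → F r p l' ≤ F r p l)
    -- (F2)
    (hF2 : ∀ M > 0, ∃ γ > 0, ∀ (a b : ℝ) (p : RE N) (l : ℝ),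
      -M ≤ b → b ≤ a → a ≤ M → γ * (a - b) ≤ F a p l - F b p l)
    -- (F3)
    (hF3 : ∀ M > 0, ∀ r > 0, ∃ ω : ℝ → ℝ, IsModulus ω ∧
      ∀ (a : ℝ) (p q : RE N) (l l' : ℝ), |a| ≤ M → ‖p‖ ≤ r → ‖q‖ ≤ r → |l| ≤ r → |l'| ≤ r →
        |F a p l - F a q l'| ≤ ω (‖p - q‖ + |l - l'|))
    -- (F4)
    (hf : UniformContinuous f)
    -- u : bounded continuous viscosity solution
    (hub : Bdd u) (huc : Continuous u)
    (husub : IsSubSol μ₁ μ₂ j₁ j₂ F f u) (husuper : IsSuperSol μ₁ μ₂ j₁ j₂ F f u)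
    -- M = ‖u‖_∞ and γ_M is the constant from (F2) for this M
    (M γ : ℝ) (hMu : ∀ x, |u x| ≤ M) (hγ : 0 < γ)
    (hγF2 : ∀ (a b : ℝ) (p : RE N) (l : ℝ),
      -M ≤ b → b ≤ a → a ≤ M → γ * (a - b) ≤ F a p l - F b p l) :
    UniformContinuous u ∧ ∀ h > 0, γ * modCont u h ≤ modCont f h := by
  have : IsFiniteMeasure μ₂ := ⟨hM2⟩
  have hM : 0 ≤ M := (abs_nonneg _).trans (hMu 0)
  have key : ∀ (k : ℝ) (x y : RE N), ‖y‖ < k → γ * (u x - u (x + y)) ≤ modCont f k := by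
    intro k x y hy
    have hmem : ∀ a b : RE N, ‖b‖ < k → |f (a + b) - f a| ≤ modCont f k :=
      fun a b hb => le_csSup (bddAbove_modCont hf k) ⟨a, b, hb, rfl⟩
    set d := (k - ‖y‖) / 4 with hd
    have hd0 : 0 < d := by linarith
    have hsqrt : Real.sqrt (2 * M / (2 * (M + 1) / d ^ 2)) ≤ d := by
      refine Real.sqrt_le_iff.2 ⟨hd0.le, ?_⟩
      rw [div_div_eq_mul_div, div_le_iff₀ (by positivity)]
      nlinarith [sq_nonneg d]
    refine sub_translate_le hj₁m hj₂m hj₂c hJ1 hJ2 hF1c hF1m hF3 huc huc husub husuper hMu hMu hγ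
      hγF2 (c := 2 * (M + 1) / d ^ 2) (by positivity) ((abs_nonneg _).trans (hmem x y hy)) y
      (fun y₁ y₂ h12 => ?_) x
    have h1 := hmem (y₂ + y) (y₁ - y₂ - y) ((norm_sub_le _ _).trans_lt (by linarith))
    rw [show y₂ + y + (y₁ - y₂ - y) = y₁ by abel] at h1
    exact (le_abs_self _).trans h1
  have habs : ∀ (k : ℝ) (x y : RE N), ‖y‖ < k → |u (x + y) - u x| ≤ modCont f k / γ := by
    intro k x y hy
    have h1 := key k x y hy
    have h2 := key k (x + y) (-y) (by rwa [norm_neg])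
    rw [add_neg_cancel_right] at h2
    rw [le_div_iff₀ hγ]
    rcases abs_cases (u (x + y) - u x) with h | h <;> rw [h.1] <;> linarith
  refine ⟨Metric.uniformContinuous_iff.2 fun τ hτ => ?_, fun h hh => ?_⟩
  · obtain ⟨δ, hδ, hfδ⟩ := Metric.uniformContinuous_iff.1 hf (γ * τ / 2) (by positivity)
    have hmod : modCont f δ ≤ γ * τ / 2 := by
      refine csSup_le ⟨_, 0, 0, by simpa using hδ, rfl⟩ ?_
      rintro _ ⟨x, y, hy, rfl⟩
      exact (hfδ (by simpa using hy)).le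
    refine ⟨δ, hδ, fun {a b} hab => ?_⟩
    have h1 := habs δ b (a - b) (by rwa [← dist_eq_norm])
    rw [add_sub_cancel, ← Real.dist_eq] at h1
    refine h1.trans_lt ((div_lt_iff₀ hγ).2 ?_)
    nlinarith
  · rw [mul_comm, ← le_div_iff₀ hγ]
    refine csSup_le ⟨_, 0, 0, by simpa using hh, rfl⟩ ?_
    rintro _ ⟨x, y, hy, rfl⟩
    exact habs h x y hy
end
end

section
/- Existence: Assume (M), (J1), (J2), (J3), (F1)–(F3) with quantities independent of M, that f is bounded and uniformly continuous, and that F(0,0,0) = 0. Then there exists a unique bounded uniformly continuous viscosity solution u of F(u,Du,L[u,Du]) = f in ℝ^N. In particular (taking F(u,p,ℓ) = −ℓ + u) there exists a unique bounded uniformly continuous viscosity solution of −L[u,Du] + u = f in ℝ^N. -/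
set_option autoImplicit false

open MeasureTheory Filter Topology Metric
open scoped InnerProductSpace ENNReal NNReal

noncomputable section

section QuadraticBounds

variable {N : ℕ}

/-- `u` is approximated at `x` by the affine function of slope `p`, up to the error `C ‖h‖ ^ 2`. -/
def QuadBound (u : RE N → ℝ) (x p : RE N) (C : ℝ) : Prop :=
  ∀ h, |u (x + h) - u x - ⟪h, p⟫_ℝ| ≤ C * ‖h‖ ^ 2

theorem QuadBound.hasGradientAt {u : RE N → ℝ} {x p : RE N} {C : ℝ} (h : QuadBound u x p C) :
    HasGradientAt u p x := by
  rw [hasGradientAt_iff_isLittleO_nhds_zero]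
  have h1 : (fun h : RE N => u (x + h) - u x - ⟪p, h⟫_ℝ) =O[𝓝 0] fun h => ‖h‖ ^ 2 := by
    refine Asymptotics.IsBigO.of_bound C (Eventually.of_forall fun y => ?_)
    have := h y
    rw [Real.norm_eq_abs, real_inner_comm, Real.norm_of_nonneg (by positivity)]
    exact this
  refine h1.trans_isLittleO ?_
  simpa using (Asymptotics.isLittleO_norm_pow_id (E' := RE N) one_lt_two)

theorem QuadBound.gradient_eq {u : RE N → ℝ} {x p : RE N} {C : ℝ} (h : QuadBound u x p C) :
    gradient u x = p :=
  h.hasGradientAt.gradient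

theorem eq_of_forall_inner_le_sq {p q : RE N} {C : ℝ}
    (h : ∀ y : RE N, ⟪y, p⟫_ℝ - ⟪y, q⟫_ℝ ≤ C * ‖y‖ ^ 2) : p = q := by
  have key : ∀ t : ℝ, 0 < t → ‖p - q‖ ^ 2 ≤ t * (C * ‖p - q‖ ^ 2) := by
    intro t ht
    have := h (t • (p - q))
    rw [← inner_sub_right, inner_smul_left, real_inner_self_eq_norm_sq, norm_smul,
      Real.norm_of_nonneg ht.le] at this
    simp only [conj_trivial] at this
    have h2 : t * ‖p - q‖ ^ 2 ≤ t * (t * (C * ‖p - q‖ ^ 2)) := by nlinarith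
    exact le_of_mul_le_mul_left h2 ht
  have hlim : Tendsto (fun t : ℝ => t * (C * ‖p - q‖ ^ 2)) (𝓝[>] 0) (𝓝 0) := by
    have : Tendsto (fun t : ℝ => t * (C * ‖p - q‖ ^ 2)) (𝓝 0) (𝓝 (0 * (C * ‖p - q‖ ^ 2))) :=
      tendsto_id.mul_const _
    rw [zero_mul] at this
    exact this.mono_left nhdsWithin_le_nhds
  have h0 : ‖p - q‖ ^ 2 ≤ 0 :=
    ge_of_tendsto hlim (eventually_nhdsWithin_of_forall fun t ht => key t ht)
  have : ‖p - q‖ = 0 := by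
    have := sq_nonneg ‖p - q‖
    exact pow_eq_zero_iff two_ne_zero |>.1 (le_antisymm h0 this)
  exact sub_eq_zero.1 (norm_eq_zero.1 this)

theorem gradient_eq_of_forall_sub_le {φ ψ : RE N → ℝ} {x : RE N}
    (hφ : DifferentiableAt ℝ φ x) (hψ : DifferentiableAt ℝ ψ x)
    (h : ∀ y, φ y - ψ y ≤ φ x - ψ x) : gradient φ x = gradient ψ x := by
  have h1 : IsLocalMax (fun y => φ y - ψ y) x := Eventually.of_forall h
  have h2 := h1.fderiv_eq_zero
  rw [fderiv_fun_sub hφ hψ, sub_eq_zero] at h2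
  simp [gradient, h2]

theorem ContDiff.continuous_gradient {φ : RE N → ℝ} {n : WithTop ℕ∞} (hφ : ContDiff ℝ n φ)
    (hn : 1 ≤ n) : Continuous (gradient φ) :=
  (InnerProductSpace.toDual ℝ (RE N)).symm.continuous.comp
    (hφ.continuous_fderiv (by rintro rfl; simp at hn))

theorem TestFn.differentiableAt {φ : RE N → ℝ} (hφ : TestFn φ) (x : RE N) :
    DifferentiableAt ℝ φ x :=
  (hφ.1.differentiable (by norm_num)) x

theorem fderiv_apply_eq_inner_gradient {φ : RE N → ℝ} (x h : RE N) :
    fderiv ℝ φ x h = ⟪h, gradient φ x⟫_ℝ := by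
  rw [real_inner_comm, inner_gradient_left]

/-- The quadratic approximation of a test function is locally uniform in the base point. -/
theorem TestFn.eventually_quadBound {φ : RE N → ℝ} (hφ : TestFn φ) (x₀ : RE N) :
    ∃ C, 0 ≤ C ∧ ∀ᶠ x in 𝓝 x₀, QuadBound φ x (gradient φ x) C := by
  obtain ⟨hc, B, hB⟩ := hφ
  have hd : ContDiff ℝ 1 (fderiv ℝ φ) := hc.fderiv_right (by norm_num)
  obtain ⟨K, t, ht, hK⟩ := hd.contDiffAt.exists_lipschitzOnWith (x := x₀)
  obtain ⟨ρ, hρ, hball⟩ := Metric.mem_nhds_iff.1 ht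
  set r := ρ / 2 with hr
  have hr0 : 0 < r := by positivity
  set G : ℝ := ‖fderiv ℝ φ x₀‖ + K * ρ with hG
  have hB0 : 0 ≤ B := (abs_nonneg _).trans (hB 0)
  have hG0 : 0 ≤ G := by positivity
  refine ⟨K + (2 * B / r ^ 2 + G / r), by positivity, ?_⟩
  filter_upwards [Metric.ball_mem_nhds x₀ hr0] with x hx h
  have hx' : dist x x₀ < r := hx
  have hxt : x ∈ t := hball (by rw [Metric.mem_ball]; linarith)
  rw [← fderiv_apply_eq_inner_gradient]
  by_cases hh : ‖h‖ < r
  · have h1 : ∀ y ∈ Metric.closedBall x ‖h‖, y ∈ t := by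
      intro y hy
      apply hball
      rw [Metric.mem_ball]
      have := dist_triangle y x x₀
      have : dist y x ≤ ‖h‖ := hy
      linarith
    have h2 := Convex.norm_image_sub_le_of_norm_fderiv_le' (𝕜 := ℝ) (f := φ)
      (C := K * ‖h‖) (s := Metric.closedBall x ‖h‖) (x := x) (y := x + h) (φ := fderiv ℝ φ x)
      (fun y _ => (hc.differentiable (by norm_num)) y)
      (fun y hy => by
        have h3 := hK.dist_le_mul y (h1 y hy) x hxt
        rw [dist_eq_norm] at h3
        refine h3.trans ?_
        gcongr
        exact hy)
      (convex_closedBall _ _) (Metric.mem_closedBall_self (norm_nonneg _))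
      (by simp [Metric.mem_closedBall, dist_eq_norm])
    simp only [add_sub_cancel_left, Real.norm_eq_abs] at h2
    refine h2.trans ?_
    have : 0 ≤ (2 * B / r ^ 2 + G / r) * ‖h‖ ^ 2 := by positivity
    nlinarith
  · push Not at hh
    have hg : ‖fderiv ℝ φ x‖ ≤ G := by
      have h3 := hK.dist_le_mul x hxt x₀ (mem_of_mem_nhds ht)
      rw [dist_eq_norm] at h3
      have h4 := norm_le_norm_add_norm_sub' (fderiv ℝ φ x) (fderiv ℝ φ x₀)
      have h5 : (K : ℝ) * dist x x₀ ≤ K * ρ := by gcongr; linarith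
      linarith
    have h6 : |fderiv ℝ φ x h| ≤ G * ‖h‖ := by
      rw [← Real.norm_eq_abs]
      exact (ContinuousLinearMap.le_opNorm _ _).trans (by gcongr)
    have h7 : 2 * B ≤ 2 * B / r ^ 2 * ‖h‖ ^ 2 := by
      rw [div_mul_eq_mul_div, le_div_iff₀ (by positivity)]
      gcongr
    have h8 : G * ‖h‖ ≤ G / r * ‖h‖ ^ 2 := by
      rw [div_mul_eq_mul_div, le_div_iff₀ (by positivity)]
      have : G * ‖h‖ * r ≤ G * ‖h‖ * ‖h‖ := by gcongr
      nlinarith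
    have h9 : 0 ≤ (K : ℝ) * ‖h‖ ^ 2 := by positivity
    have h10 := abs_sub (φ (x + h) - φ x) (fderiv ℝ φ x h)
    have h11 := abs_sub (φ (x + h)) (φ x)
    have h12 := hB (x + h)
    have h13 := hB x
    have : (K + (2 * B / r ^ 2 + G / r)) * ‖h‖ ^ 2
      = K * ‖h‖ ^ 2 + (2 * B / r ^ 2 * ‖h‖ ^ 2 + G / r * ‖h‖ ^ 2) := by ring
    rw [this]
    linarith

theorem TestFn.quadBound {φ : RE N → ℝ} (hφ : TestFn φ) (x : RE N) :
    ∃ C, 0 ≤ C ∧ QuadBound φ x (gradient φ x) C := by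
  obtain ⟨C, hC, h⟩ := hφ.eventually_quadBound x
  exact ⟨C, hC, h.self_of_nhds⟩

end QuadraticBounds

section Well

variable {N : ℕ}

/-- A bounded smooth well, with a nondegenerate strict global minimum at the origin. -/
def well (y : RE N) : ℝ := ‖y‖ ^ 2 / (1 + ‖y‖ ^ 2)

/-- The gradient of `well`. -/
def wellGrad (y : RE N) : RE N := (2 / (1 + ‖y‖ ^ 2) ^ 2) • y

theorem well_nonneg (y : RE N) : 0 ≤ well y := by unfold well; positivity

theorem well_zero : well (0 : RE N) = 0 := by simp [well]

theorem wellGrad_zero : wellGrad (0 : RE N) = 0 := by simp [wellGrad]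

theorem well_le_one (y : RE N) : well y ≤ 1 := by
  unfold well
  rw [div_le_one (by positivity)]
  linarith

theorem well_ge {r : ℝ} (hr : 0 ≤ r) {y : RE N} (h : r ≤ ‖y‖) : r ^ 2 / (1 + r ^ 2) ≤ well y := by
  unfold well
  rw [div_le_div_iff₀ (by positivity) (by positivity)]
  have : r ^ 2 ≤ ‖y‖ ^ 2 := by gcongr
  nlinarith

theorem contDiff_well {n : WithTop ℕ∞} : ContDiff ℝ n (well : RE N → ℝ) := by
  unfold well
  refine (contDiff_norm_sq ℝ).div (contDiff_const.add (contDiff_norm_sq ℝ)) fun y => ?_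
  positivity

theorem testFn_well : TestFn (well : RE N → ℝ) :=
  ⟨contDiff_well, 1, fun y => by rw [abs_of_nonneg (well_nonneg y)]; exact well_le_one y⟩

theorem norm_wellGrad_le (y : RE N) : ‖wellGrad y‖ ≤ 2 := by
  unfold wellGrad
  rw [norm_smul, Real.norm_of_nonneg (by positivity), div_mul_eq_mul_div,
    div_le_iff₀ (by positivity)]
  have : ‖y‖ ≤ 1 + ‖y‖ ^ 2 := by nlinarith [sq_nonneg (‖y‖ - 1), sq_nonneg ‖y‖]
  nlinarith [sq_nonneg (‖y‖ ^ 2)]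

theorem quadBound_well (y : RE N) : QuadBound well y (wellGrad y) 8 := by
  intro h
  have hab : ‖y + h‖ ^ 2 = ‖y‖ ^ 2 + 2 * ⟪y, h⟫_ℝ + ‖h‖ ^ 2 := norm_add_sq_real y h
  have ht := abs_real_inner_le_norm y h
  unfold well wellGrad
  rw [real_inner_smul_right, real_inner_comm]
  set b := ‖y + h‖ ^ 2 with hb
  set t := ⟪y, h⟫_ℝ
  have hb0 : 0 ≤ b := by positivity
  have ht2 : t ^ 2 ≤ ‖y‖ ^ 2 * ‖h‖ ^ 2 := by
    rw [← mul_pow, ← sq_abs t]; gcongr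
  set a := ‖y‖ ^ 2
  set k := ‖h‖ ^ 2
  have ha0 : 0 ≤ a := by positivity
  have hk0 : 0 ≤ k := by positivity
  have htk : |2 * t| ≤ a + k := by
    have := sq_nonneg (‖y‖ - ‖h‖)
    rw [abs_mul, abs_two]
    nlinarith
  have hk : k ≤ 2 * a + 2 * b := by
    have h1 : 0 ≤ ‖h + (2 : ℝ) • y‖ ^ 2 := by positivity
    rw [norm_add_sq_real, real_inner_smul_right, norm_smul, mul_pow, real_inner_comm] at h1
    simp only [Real.norm_ofNat] at h1
    change 0 ≤ k + 2 * (2 * t) + 2 ^ 2 * a at h1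
    linarith
  have e : b / (1 + b) - a / (1 + a) - 2 / (1 + a) ^ 2 * t
      = (k * (1 + a) - 4 * t ^ 2 - 2 * t * k) / ((1 + a) ^ 2 * (1 + b)) := by
    have h1 : 1 + a ≠ 0 := by positivity
    have h2 : 1 + b ≠ 0 := by positivity
    rw [hab] at h2 ⊢
    field_simp
    ring
  rw [e, abs_div, abs_of_pos (a := (1 + a) ^ 2 * (1 + b)) (by positivity),
    div_le_iff₀ (by positivity)]
  have h1 : |2 * t * k| ≤ k * (3 * a + 2 * b) := by
    rw [abs_mul, abs_of_nonneg hk0, mul_comm]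
    gcongr
    linarith
  have h2 := abs_le.1 h1
  have h3 : 1 + a + 4 * a + (3 * a + 2 * b) ≤ 8 * ((1 + a) ^ 2 * (1 + b)) := by
    nlinarith [mul_nonneg ha0 hb0, mul_nonneg (mul_nonneg ha0 ha0) hb0, mul_nonneg ha0 ha0]
  have h4 := mul_le_mul_of_nonneg_left h3 hk0
  rw [abs_le]
  constructor <;> nlinarith [mul_nonneg hk0 ha0]

end Well

section Convergence

theorem clamp_sub_abs_le {B R t : ℝ} (hB : 0 ≤ B) (hR : 0 ≤ R) (h : |t| ≤ B + R) :
    |t - max (-B) (min t B)| ≤ R := by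
  rw [abs_le] at *
  rcases le_total t B with h1 | h1 <;> rcases le_total (-B) t with h2 | h2
  · rw [min_eq_left h1, max_eq_right h2]; constructor <;> linarith
  · rw [min_eq_left h1, max_eq_left h2]; constructor <;> linarith
  · rw [min_eq_right h1, max_eq_right (by linarith)]; constructor <;> linarith
  · rw [min_eq_right h1, max_eq_right (by linarith)]; constructor <;> linarith

/-- Dominated convergence with a bound that is fixed up to a perturbation vanishing in `L¹`. -/
theorem tendsto_integral_of_abs_le_add {α ι : Type*} [MeasurableSpace α] {μ : Measure α}
    {l : Filter ι} [l.IsCountablyGenerated] [l.NeBot] {F R : ι → α → ℝ} {f B : α → ℝ}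
    (hFm : ∀ n, AEStronglyMeasurable (F n) μ) (hB : Integrable B μ) (hB0 : ∀ a, 0 ≤ B a)
    (hR : ∀ n, Integrable (R n) μ) (hR0 : ∀ n a, 0 ≤ R n a)
    (hF : ∀ᶠ n in l, ∀ a, |F n a| ≤ B a + R n a)
    (hRint : Tendsto (fun n => ∫ a, R n a ∂μ) l (𝓝 0))
    (hRlim : ∀ᵐ a ∂μ, Tendsto (fun n => R n a) l (𝓝 0))
    (hlim : ∀ᵐ a ∂μ, Tendsto (fun n => F n a) l (𝓝 (f a))) :
    Tendsto (fun n => ∫ a, F n a ∂μ) l (𝓝 (∫ a, f a ∂μ)) := by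
  have hHm : ∀ n, AEStronglyMeasurable (fun a => max (-B a) (min (F n a) (B a))) μ := fun n =>
    (hB.1.neg).sup ((hFm n).inf hB.1)
  have hHb : ∀ n a, ‖max (-B a) (min (F n a) (B a))‖ ≤ B a := by
    intro n a
    rw [Real.norm_eq_abs, abs_le]
    exact ⟨le_max_left _ _, max_le (by linarith [hB0 a]) (min_le_right _ _)⟩
  have hHi : ∀ n, Integrable (fun a => max (-B a) (min (F n a) (B a))) μ := fun n =>
    hB.mono' (hHm n) (Eventually.of_forall (hHb n))
  have hH : Tendsto (fun n => ∫ a, max (-B a) (min (F n a) (B a)) ∂μ) l (𝓝 (∫ a, f a ∂μ)) := by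
    refine tendsto_integral_filter_of_dominated_convergence B (Eventually.of_forall hHm)
      (Eventually.of_forall fun n => Eventually.of_forall (hHb n)) hB ?_
    filter_upwards [hRlim, hlim] with a h1 h2
    have hfB : |f a| ≤ B a + 0 :=
      le_of_tendsto_of_tendsto h2.abs (h1.const_add _) (hF.mono fun n hn => hn a)
    rw [add_zero, abs_le] at hfB
    have h3 := (h2.min (tendsto_const_nhds (x := B a))).max (tendsto_const_nhds (x := -B a))
    rw [min_eq_left hfB.2, max_eq_left hfB.1] at h3
    simpa only [max_comm] using h3
  have hdm : ∀ n, AEStronglyMeasurable (fun a => F n a - max (-B a) (min (F n a) (B a))) μ :=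
    fun n => (hFm n).sub (hHm n)
  have hdb : ∀ᶠ n in l, ∀ a, ‖F n a - max (-B a) (min (F n a) (B a))‖ ≤ R n a :=
    hF.mono fun n hn a => clamp_sub_abs_le (hB0 a) (hR0 n a) (hn a)
  have hd : Tendsto (fun n => ∫ a, (F n a - max (-B a) (min (F n a) (B a))) ∂μ) l (𝓝 0) := by
    refine squeeze_zero_norm' ?_ hRint
    exact hdb.mono fun n hn => norm_integral_le_of_norm_le (hR n) (Eventually.of_forall hn)
  have hsum := hd.add hH
  rw [zero_add] at hsum
  refine hsum.congr' ?_
  filter_upwards [hdb] with n hn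
  rw [← integral_add ((hR n).mono' (hdm n) (Eventually.of_forall hn)) (hHi n)]
  simp

end Convergence

/-- The properties of the jumps used in the theory: continuity in the gradient variable, almost
everywhere and, for `j₁`, in `L²`. -/
structure JumpHyp {N P : ℕ} (μ₁ μ₂ : Measure (RE P)) (j₁ j₂ : RE N → RE P → RE N) : Prop where
  fin : IsFiniteMeasure μ₂
  meas₁ : ∀ p, Measurable (j₁ p)
  meas₂ : ∀ p, Measurable (j₂ p)
  cont₁ : ∀ᵐ z ∂μ₁, Continuous fun p => j₁ p z
  cont₂ : ∀ᵐ z ∂μ₂, Continuous fun p => j₂ p z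
  int₁ : ∀ p, Integrable (fun z => ‖j₁ p z‖ ^ 2) μ₁
  bdd₁ : ∀ r, ∃ C, ∀ p, ‖p‖ ≤ r → ∫ z, ‖j₁ p z‖ ^ 2 ∂μ₁ ≤ C
  tend₁ : ∀ p, Tendsto (fun q => ∫ z, ‖j₁ q z - j₁ p z‖ ^ 2 ∂μ₁) (𝓝 p) (𝓝 0)

/-- The nonlocal operator evaluated at a point `x` with a prescribed slope `p`. -/
def Lam {N P : ℕ} (μ₁ μ₂ : Measure (RE P)) (j₁ j₂ : RE N → RE P → RE N)
    (u : RE N → ℝ) (x p : RE N) : ℝ :=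
  (∫ z, (u (x + j₁ p z) - u x - ⟪j₁ p z, p⟫_ℝ) ∂μ₁) + ∫ z, (u (x + j₂ p z) - u x) ∂μ₂

section Nonlocal

variable {N P : ℕ} {μ₁ μ₂ : Measure (RE P)} {j₁ j₂ : RE N → RE P → RE N}

theorem Lop_eq_Lam (φ : RE N → ℝ) (x : RE N) :
    Lop μ₁ μ₂ j₁ j₂ φ x = Lam μ₁ μ₂ j₁ j₂ φ x (gradient φ x) := rfl

theorem norm_sq_le_two_mul_add {E : Type*} [NormedAddCommGroup E] (a b : E) :
    ‖a‖ ^ 2 ≤ 2 * ‖b‖ ^ 2 + 2 * ‖a - b‖ ^ 2 := by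
  have h := norm_le_norm_add_norm_sub' a b
  have h1 : ‖a‖ ^ 2 ≤ (‖b‖ + ‖a - b‖) ^ 2 := by gcongr
  nlinarith [sq_nonneg (‖b‖ - ‖a - b‖)]

namespace JumpHyp

theorem reflect (H : JumpHyp μ₁ μ₂ j₁ j₂) :
    JumpHyp μ₁ μ₂ (fun p => j₁ (-p)) (fun p => j₂ (-p)) where
  fin := H.fin
  meas₁ p := H.meas₁ (-p)
  meas₂ p := H.meas₂ (-p)
  cont₁ := H.cont₁.mono fun _ h => h.comp continuous_neg
  cont₂ := H.cont₂.mono fun _ h => h.comp continuous_neg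
  int₁ p := H.int₁ (-p)
  bdd₁ r := by
    obtain ⟨C, hC⟩ := H.bdd₁ r
    exact ⟨C, fun p hp => hC (-p) (by rwa [norm_neg])⟩
  tend₁ p := (H.tend₁ (-p)).comp (continuous_neg.tendsto p)

theorem integrable_sub (H : JumpHyp μ₁ μ₂ j₁ j₂) (p q : RE N) :
    Integrable (fun z => ‖j₁ p z - j₁ q z‖ ^ 2) μ₁ := by
  refine (((H.int₁ p).const_mul 2).add ((H.int₁ q).const_mul 2)).mono'
    ((((H.meas₁ p).sub (H.meas₁ q)).norm.pow_const 2).aestronglyMeasurable)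
    (Eventually.of_forall fun z => ?_)
  rw [Real.norm_of_nonneg (by positivity)]
  have := norm_sub_le (j₁ p z) (j₁ q z)
  have h1 : ‖j₁ p z - j₁ q z‖ ^ 2 ≤ (‖j₁ p z‖ + ‖j₁ q z‖) ^ 2 := by gcongr
  simp only [Pi.add_apply]
  nlinarith [sq_nonneg (‖j₁ p z‖ - ‖j₁ q z‖)]

theorem tendsto_integral₁ (H : JumpHyp μ₁ μ₂ j₁ j₂) {ι : Type*} {l : Filter ι}
    [l.IsCountablyGenerated] [l.NeBot] {p q : ι → RE N} {p₀ : RE N} (hp : Tendsto p l (𝓝 p₀))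
    (hq : Tendsto q l (𝓝 p₀)) {g : ι → RE P → ℝ} {g₀ : RE P → ℝ} {C : ℝ} (hC : 0 ≤ C)
    (hm : ∀ n, AEStronglyMeasurable (g n) μ₁)
    (hb : ∀ᶠ n in l, ∀ z, |g n z| ≤ C * (‖j₁ (p n) z‖ ^ 2 + ‖j₁ (q n) z‖ ^ 2))
    (hlim : ∀ᵐ z ∂μ₁, Tendsto (fun n => g n z) l (𝓝 (g₀ z))) :
    Tendsto (fun n => ∫ z, g n z ∂μ₁) l (𝓝 (∫ z, g₀ z ∂μ₁)) := by
  refine tendsto_integral_of_abs_le_add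
    (B := fun z => 4 * C * ‖j₁ p₀ z‖ ^ 2)
    (R := fun n z => 2 * C * (‖j₁ (p n) z - j₁ p₀ z‖ ^ 2 + ‖j₁ (q n) z - j₁ p₀ z‖ ^ 2))
    hm ((H.int₁ p₀).const_mul _) (fun z => by positivity)
    (fun n => ((H.integrable_sub _ _).add (H.integrable_sub _ _)).const_mul _)
    (fun n z => by positivity) ?_ ?_ ?_ hlim
  · filter_upwards [hb] with n hn z
    have h1 := norm_sq_le_two_mul_add (j₁ (p n) z) (j₁ p₀ z)
    have h2 := norm_sq_le_two_mul_add (j₁ (q n) z) (j₁ p₀ z)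
    have h3 := mul_le_mul_of_nonneg_left (add_le_add h1 h2) hC
    linarith [hn z]
  · have h := (((H.tend₁ p₀).comp hp).add ((H.tend₁ p₀).comp hq)).const_mul (2 * C)
    rw [add_zero, mul_zero] at h
    refine h.congr fun n => ?_
    rw [integral_const_mul, integral_add (H.integrable_sub _ _) (H.integrable_sub _ _)]
    rfl
  · filter_upwards [H.cont₁] with z hz
    have h1 : ∀ r : ι → RE N, Tendsto r l (𝓝 p₀) →
        Tendsto (fun n => ‖j₁ (r n) z - j₁ p₀ z‖ ^ 2) l (𝓝 0) := by
      intro r hr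
      have := ((((hz.tendsto p₀).comp hr).sub_const (j₁ p₀ z)).norm).pow 2
      simpa using this
    have := ((h1 p hp).add (h1 q hq)).const_mul (2 * C)
    simpa using this

theorem integrable₁ (H : JumpHyp μ₁ μ₂ j₁ j₂) {u : RE N → ℝ} (hu : Continuous u) {x q : RE N}
    {C : ℝ} (h : QuadBound u x q C) (p : RE N) :
    Integrable (fun z => u (x + j₁ p z) - u x - ⟪j₁ p z, q⟫_ℝ) μ₁ := by
  refine ((H.int₁ p).const_mul C).mono' ?_ (Eventually.of_forall fun z => h _)
  have : Continuous fun a : RE N => u (x + a) - u x - ⟪a, q⟫_ℝ := by fun_prop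
  exact (this.measurable.comp (H.meas₁ p)).aestronglyMeasurable

theorem integrable₂ (H : JumpHyp μ₁ μ₂ j₁ j₂) {u : RE N → ℝ} (hu : Continuous u) (hb : Bdd u)
    (x p : RE N) : Integrable (fun z => u (x + j₂ p z) - u x) μ₂ := by
  obtain ⟨B, hB⟩ := hb
  have := H.fin
  refine (integrable_const (2 * B)).mono' ?_ (Eventually.of_forall fun z => ?_)
  · have : Continuous fun a : RE N => u (x + a) - u x := by fun_prop
    exact (this.measurable.comp (H.meas₂ p)).aestronglyMeasurable
  · have := abs_sub (u (x + j₂ p z)) (u x)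
    have h1 := hB (x + j₂ p z)
    have h2 := hB x
    rw [Real.norm_eq_abs]
    linarith

/-- Stability of the nonlocal operator under convergence of the function, the point and the
slope. -/
theorem tendsto_Lam (H : JumpHyp μ₁ μ₂ j₁ j₂) {ι : Type*} {l : Filter ι}
    [l.IsCountablyGenerated] [l.NeBot] {u : ι → RE N → ℝ} {u₀ : RE N → ℝ} {x p : ι → RE N}
    {x₀ p₀ : RE N} {B C : ℝ} (hC : 0 ≤ C) (hu : ∀ n, Continuous (u n))
    (hB : ∀ n y, |u n y| ≤ B) (hp : Tendsto p l (𝓝 p₀))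
    (hQ : ∀ᶠ n in l, QuadBound (u n) (x n) (p n) C)
    (hlim : ∀ (a : ι → RE N) (a₀ : RE N), Tendsto a l (𝓝 a₀) →
      Tendsto (fun n => u n (x n + a n)) l (𝓝 (u₀ (x₀ + a₀)))) :
    Tendsto (fun n => Lam μ₁ μ₂ j₁ j₂ (u n) (x n) (p n)) l
      (𝓝 (Lam μ₁ μ₂ j₁ j₂ u₀ x₀ p₀)) := by
  have h0 : Tendsto (fun n => u n (x n)) l (𝓝 (u₀ x₀)) := by
    simpa using hlim (fun _ => 0) 0 tendsto_const_nhds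
  have := H.fin
  refine Tendsto.add ?_ ?_
  · refine H.tendsto_integral₁ hp hp hC (fun n => ?_) (hQ.mono fun n hn z => ?_) ?_
    · have := hu n
      have : Continuous fun a : RE N => u n (x n + a) - u n (x n) - ⟪a, p n⟫_ℝ := by fun_prop
      exact (this.measurable.comp (H.meas₁ _)).aestronglyMeasurable
    · have h1 : 0 ≤ C * ‖j₁ (p n) z‖ ^ 2 := by positivity
      linarith [hn (j₁ (p n) z)]
    · filter_upwards [H.cont₁] with z hz
      have hz' := (hz.tendsto p₀).comp hp
      exact ((hlim _ _ hz').sub h0).sub (hz'.inner hp)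
  · refine tendsto_integral_filter_of_dominated_convergence (fun _ => 2 * B)
      (Eventually.of_forall fun n => ?_) (Eventually.of_forall fun n => Eventually.of_forall
      fun z => ?_) (integrable_const _) ?_
    · have := hu n
      have : Continuous fun a : RE N => u n (x n + a) - u n (x n) := by fun_prop
      exact (this.measurable.comp (H.meas₂ _)).aestronglyMeasurable
    · have := abs_sub (u n (x n + j₂ (p n) z)) (u n (x n))
      have h1 := hB n (x n + j₂ (p n) z)
      have h2 := hB n (x n)
      rw [Real.norm_eq_abs]
      linarith
    · filter_upwards [H.cont₂] with z hz
      exact (hlim _ _ ((hz.tendsto p₀).comp hp)).sub h0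

theorem continuous_Lop (H : JumpHyp μ₁ μ₂ j₁ j₂) {φ : RE N → ℝ} (hφ : TestFn φ) :
    Continuous (Lop μ₁ μ₂ j₁ j₂ φ) := by
  rw [continuous_iff_continuousAt]
  intro x₀
  obtain ⟨C, hC, hQ⟩ := hφ.eventually_quadBound x₀
  obtain ⟨B, hB⟩ := hφ.2
  exact H.tendsto_Lam (u := fun _ => φ) (x := fun x => x) (B := B) hC
    (fun _ => hφ.1.continuous) (fun _ => hB)
    ((hφ.1.continuous_gradient (by norm_num)).tendsto x₀) hQ
    fun a a₀ ha => (hφ.1.continuous.tendsto _).comp (tendsto_id.add ha)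

end JumpHyp

end Nonlocal

section PointwiseInequality

variable {N P : ℕ} {μ₁ μ₂ : Measure (RE P)} {j₁ j₂ : RE N → RE P → RE N}
  {F : ℝ → RE N → ℝ → ℝ} {f : RE N → ℝ}

/-- A bounded continuous function with a quadratic approximation at `x` is uniformly approximated
by test functions touching it from above at `x`. -/
theorem QuadBound.exists_testFn_ge {u : RE N → ℝ} (hu : Continuous u) {B : ℝ}
    (hB : ∀ y, |u y| ≤ B) {x p : RE N} {C : ℝ} (hC : 0 ≤ C) (hQ : QuadBound u x p C) {r : ℝ}
    (hr : 0 < r) :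
    ∃ φ, TestFn φ ∧ (∀ y, u y ≤ φ y) ∧ φ x = u x ∧ QuadBound φ x p (C + 2) ∧
      ∀ y, |φ y - u y| ≤ (2 + 8 * C) * r ^ 2 := by
  obtain ⟨v, hv, hvu, -⟩ := Continuous.exists_contDiff_approx (E := RE N) 2
    (f := fun y => u y + r ^ 2) (ε := fun _ => r ^ 2) (by fun_prop) continuous_const
    (fun _ => by positivity)
  have hv1 : ∀ y, u y ≤ v y ∧ v y ≤ u y + 2 * r ^ 2 := by
    intro y
    have := hvu y
    rw [Real.dist_eq, abs_lt] at this
    constructor <;> linarith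
  let χ : ContDiffBump x := ⟨r, 2 * r, hr, by linarith⟩
  let Q : RE N → ℝ := fun y => u x + ⟪y - x, p⟫_ℝ + C * ‖y - x‖ ^ 2
  have hQu : ∀ y, u y ≤ Q y ∧ Q y ≤ u y + 2 * C * ‖y - x‖ ^ 2 := by
    intro y
    have := hQ (y - x)
    rw [add_sub_cancel, abs_le] at this
    simp only [Q]
    constructor <;> linarith
  have hχ0 : ∀ y, 0 ≤ χ y := fun y => χ.nonneg
  have hχ1 : ∀ y, χ y ≤ 1 := fun y => χ.le_one
  have hdiff : ∀ y, |(1 - χ y) * v y + χ y * Q y - u y| ≤ (2 + 8 * C) * r ^ 2 ∧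
      u y ≤ (1 - χ y) * v y + χ y * Q y := by
    intro y
    have e : (1 - χ y) * v y + χ y * Q y - u y
        = (1 - χ y) * (v y - u y) + χ y * (Q y - u y) := by ring
    have h1 : 0 ≤ (1 - χ y) * (v y - u y) :=
      mul_nonneg (by linarith [hχ1 y]) (by linarith [hv1 y])
    have h2 : 0 ≤ χ y * (Q y - u y) := mul_nonneg (hχ0 y) (by linarith [hQu y])
    have h3 : (1 - χ y) * (v y - u y) ≤ 2 * r ^ 2 := by
      have : (1 - χ y) * (v y - u y) ≤ 1 * (v y - u y) := by
        gcongr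
        · linarith [hv1 y]
        · linarith [hχ0 y]
      linarith [hv1 y]
    have h4 : χ y * (Q y - u y) ≤ 8 * C * r ^ 2 := by
      by_cases hy : dist y x < 2 * r
      · rw [dist_eq_norm] at hy
        have h5 : χ y * (Q y - u y) ≤ 1 * (Q y - u y) := by
          gcongr
          · linarith [hQu y]
          · exact hχ1 y
        have h6 : ‖y - x‖ ^ 2 ≤ (2 * r) ^ 2 := by gcongr
        have h7 := mul_le_mul_of_nonneg_left h6 hC
        linarith [hQu y]
      · rw [χ.zero_of_le_dist (not_lt.1 hy), zero_mul]
        positivity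
    constructor
    · rw [e, abs_of_nonneg (by linarith)]
      linarith
    · linarith
  have hx : χ x = 1 := χ.one_of_mem_closedBall (Metric.mem_closedBall_self χ.rIn_pos.le)
  have hφx : (1 - χ x) * v x + χ x * Q x = u x := by rw [hx]; simp [Q]
  refine ⟨fun y => (1 - χ y) * v y + χ y * Q y, ⟨?_, B + (2 + 8 * C) * r ^ 2, ?_⟩,
    fun y => (hdiff y).2, hφx, ?_, fun y => (hdiff y).1⟩
  · have hQ2 : ContDiff ℝ 2 Q := by
      refine (contDiff_const.add ?_).add (contDiff_const.mul ?_)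
      · exact (contDiff_id.sub contDiff_const).inner ℝ contDiff_const
      · exact (contDiff_norm_sq ℝ).comp (contDiff_id.sub contDiff_const)
    exact ((contDiff_const.sub χ.contDiff).mul hv).add (χ.contDiff.mul hQ2)
  · intro y
    have h1 := abs_add_le (u y) ((1 - χ y) * v y + χ y * Q y - u y)
    rw [add_sub_cancel] at h1
    linarith [hB y, (hdiff y).1]
  · intro h
    simp only [hφx]
    have hQh : Q (x + h) = u x + ⟪h, p⟫_ℝ + C * ‖h‖ ^ 2 := by simp [Q]
    have hsq : 0 ≤ ‖h‖ ^ 2 := by positivity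
    have hCh : 0 ≤ C * ‖h‖ ^ 2 := by positivity
    by_cases hh : ‖h‖ ≤ r
    · rw [χ.one_of_mem_closedBall (by simpa [Metric.mem_closedBall, dist_eq_norm] using hh), hQh]
      have e : (1 - 1) * v (x + h) + 1 * (u x + ⟪h, p⟫_ℝ + C * ‖h‖ ^ 2) - u x - ⟪h, p⟫_ℝ
          = C * ‖h‖ ^ 2 := by ring
      rw [e, abs_of_nonneg hCh]
      linarith
    · have h1 := hQ h
      rw [abs_le] at h1 ⊢
      have h2 := hv1 (x + h)
      have h3 : r ^ 2 ≤ ‖h‖ ^ 2 := by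
        have := (not_le.1 hh).le
        gcongr
      have h4 : v (x + h) - u x - ⟪h, p⟫_ℝ ≤ (C + 2) * ‖h‖ ^ 2 := by linarith
      have h5 : -(C * ‖h‖ ^ 2) ≤ v (x + h) - u x - ⟪h, p⟫_ℝ := by linarith
      have e : (1 - χ (x + h)) * v (x + h) + χ (x + h) * Q (x + h) - u x - ⟪h, p⟫_ℝ
          = (1 - χ (x + h)) * (v (x + h) - u x - ⟪h, p⟫_ℝ) + χ (x + h) * (C * ‖h‖ ^ 2) := by
        rw [hQh]; ring
      rw [e]
      have h6 := hχ0 (x + h)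
      have h7 : 0 ≤ 1 - χ (x + h) := by linarith [hχ1 (x + h)]
      have h8 := mul_le_mul_of_nonneg_left h4 h7
      have h9 := mul_le_mul_of_nonneg_left h5 h7
      have h10 := mul_nonneg h6 hsq
      have h11 := mul_nonneg h6 hCh
      have h12 := mul_nonneg h7 hsq
      constructor <;> nlinarith

/-- The subsolution inequality holds pointwise with the nonlocal operator of the subsolution itself
wherever the subsolution has a quadratic approximation. -/
theorem IsSubSol.le_of_quadBound (H : JumpHyp μ₁ μ₂ j₁ j₂)
    (hF : Continuous fun t : ℝ × RE N × ℝ => F t.1 t.2.1 t.2.2) {u : RE N → ℝ}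
    (hsub : IsSubSol μ₁ μ₂ j₁ j₂ F f u) (hu : Continuous u) (hb : Bdd u) {x p : RE N} {C : ℝ}
    (hC : 0 ≤ C) (hQ : QuadBound u x p C) :
    F (u x) p (Lam μ₁ μ₂ j₁ j₂ u x p) ≤ f x := by
  obtain ⟨B, hB⟩ := hb
  have hr : ∀ n : ℕ, 0 < 1 / ((n : ℝ) + 1) := fun n => by positivity
  choose φ hφ hφu hφx hφQ hφd using fun n : ℕ => hQ.exists_testFn_ge hu hB hC (hr n)
  have hrt : Tendsto (fun n : ℕ => (2 + 8 * C) * (1 / ((n : ℝ) + 1)) ^ 2) atTop (𝓝 0) := by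
    have := (tendsto_one_div_add_atTop_nhds_zero_nat (𝕜 := ℝ)).pow 2 |>.const_mul (2 + 8 * C)
    simpa using this
  have hlim : Tendsto (fun n => Lam μ₁ μ₂ j₁ j₂ (φ n) x p) atTop
      (𝓝 (Lam μ₁ μ₂ j₁ j₂ u x p)) := by
    refine H.tendsto_Lam (x := fun _ => x) (p := fun _ => p) (B := B + (2 + 8 * C))
      (C := C + 2) (by positivity)
      (fun n => (hφ n).1.continuous) (fun n y => ?_) tendsto_const_nhds
      (Eventually.of_forall hφQ) fun a a₀ ha => ?_
    · have h1 := abs_add_le (u y) (φ n y - u y)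
      rw [add_sub_cancel] at h1
      have h2 : (1 / ((n : ℝ) + 1)) ^ 2 ≤ 1 := by
        refine pow_le_one₀ (hr n).le ?_
        rw [div_le_one (by positivity)]
        linarith [n.cast_nonneg (α := ℝ)]
      have h3 : (2 + 8 * C) * (1 / ((n : ℝ) + 1)) ^ 2 ≤ (2 + 8 * C) * 1 := by gcongr
      linarith [hB y, hφd n y]
    · have h1 : Tendsto (fun n => u (x + a n)) atTop (𝓝 (u (x + a₀))) :=
        (hu.tendsto _).comp (ha.const_add x)
      have h2 : Tendsto (fun n => φ n (x + a n) - u (x + a n)) atTop (𝓝 0) :=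
        squeeze_zero_norm (fun n => hφd n _) hrt
      simpa using h2.add h1
  have hFl : Tendsto (fun n => F (u x) p (Lam μ₁ μ₂ j₁ j₂ (φ n) x p)) atTop
      (𝓝 (F (u x) p (Lam μ₁ μ₂ j₁ j₂ u x p))) :=
    (hF.tendsto (u x, p, _)).comp (tendsto_const_nhds.prodMk_nhds
      (tendsto_const_nhds.prodMk_nhds hlim))
  refine le_of_tendsto hFl (Eventually.of_forall fun n => ?_)
  have := hsub (φ n) (hφ n) x fun y => by linarith [hφu n y, hφx n]
  rwa [Lop_eq_Lam, (hφQ n).gradient_eq] at this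

theorem QuadBound.neg {u : RE N → ℝ} {x p : RE N} {C : ℝ} (h : QuadBound u x p C) :
    QuadBound (fun y => -u y) x (-p) C := by
  intro y
  have := h y
  rw [← abs_neg, inner_neg_right]
  convert this using 2
  ring

theorem Bdd.neg {u : RE N → ℝ} (h : Bdd u) : Bdd fun y => -u y := by
  obtain ⟨C, hC⟩ := h
  exact ⟨C, fun x => by rw [abs_neg]; exact hC x⟩

theorem Lam_neg (u : RE N → ℝ) (x p : RE N) :
    Lam μ₁ μ₂ (fun p => j₁ (-p)) (fun p => j₂ (-p)) (fun y => -u y) x (-p)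
      = -Lam μ₁ μ₂ j₁ j₂ u x p := by
  unfold Lam
  rw [neg_add, ← integral_neg, ← integral_neg]
  simp only [neg_neg, inner_neg_right]
  congr 2 <;> ext z <;> ring

theorem gradient_fun_neg (φ : RE N → ℝ) (x : RE N) :
    gradient (fun y => -φ y) x = -gradient φ x := by
  simp only [gradient, fderiv_fun_neg, map_neg]

/-- The symmetry exchanging supersolutions and subsolutions. -/
theorem IsSuperSol.neg {u : RE N → ℝ} (h : IsSuperSol μ₁ μ₂ j₁ j₂ F f u) :
    IsSubSol μ₁ μ₂ (fun p => j₁ (-p)) (fun p => j₂ (-p)) (fun r p l => -F (-r) (-p) (-l))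
      (fun y => -f y) (fun y => -u y) := by
  intro φ hφ x hx
  have h1 := h (fun y => -φ y) ⟨hφ.1.neg, Bdd.neg hφ.2⟩ x fun y => by linarith [hx y]
  have h2 := Lam_neg (μ₁ := μ₁) (μ₂ := μ₂) (j₁ := j₁) (j₂ := j₂) (fun y => -φ y) x (-gradient φ x)
  simp only [neg_neg] at h2
  rw [Lop_eq_Lam, gradient_fun_neg] at h1
  rw [Lop_eq_Lam, h2]
  simp only [neg_neg]
  linarith

theorem IsSubSol.neg {u : RE N → ℝ} (h : IsSubSol μ₁ μ₂ j₁ j₂ F f u) :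
    IsSuperSol μ₁ μ₂ (fun p => j₁ (-p)) (fun p => j₂ (-p)) (fun r p l => -F (-r) (-p) (-l))
      (fun y => -f y) (fun y => -u y) := by
  intro φ hφ x hx
  have h1 := h (fun y => -φ y) ⟨hφ.1.neg, Bdd.neg hφ.2⟩ x fun y => by linarith [hx y]
  have h2 := Lam_neg (μ₁ := μ₁) (μ₂ := μ₂) (j₁ := j₁) (j₂ := j₂) (fun y => -φ y) x (-gradient φ x)
  simp only [neg_neg] at h2
  rw [Lop_eq_Lam, gradient_fun_neg] at h1
  rw [Lop_eq_Lam, h2]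
  simp only [neg_neg]
  linarith

theorem continuous_reflect (hF : Continuous fun t : ℝ × RE N × ℝ => F t.1 t.2.1 t.2.2) :
    Continuous fun t : ℝ × RE N × ℝ => -F (-t.1) (-t.2.1) (-t.2.2) :=
  (hF.comp (continuous_neg (G := ℝ × RE N × ℝ))).neg

theorem IsSuperSol.le_of_quadBound (H : JumpHyp μ₁ μ₂ j₁ j₂)
    (hF : Continuous fun t : ℝ × RE N × ℝ => F t.1 t.2.1 t.2.2) {u : RE N → ℝ}
    (hsuper : IsSuperSol μ₁ μ₂ j₁ j₂ F f u) (hu : Continuous u) (hb : Bdd u) {x p : RE N} {C : ℝ}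
    (hC : 0 ≤ C) (hQ : QuadBound u x p C) :
    f x ≤ F (u x) p (Lam μ₁ μ₂ j₁ j₂ u x p) := by
  have h := hsuper.neg.le_of_quadBound H.reflect (continuous_reflect hF) hu.neg hb.neg hC hQ.neg
  rw [Lam_neg] at h
  simpa using h

end PointwiseInequality

section SupConvolution

variable {N P : ℕ} {μ₁ μ₂ : Measure (RE P)} {j₁ j₂ : RE N → RE P → RE N}
  {F : ℝ → RE N → ℝ → ℝ} {f : RE N → ℝ}

theorem gradient_comp_add_const (φ : RE N → ℝ) (c x : RE N) :
    gradient (fun y => φ (y + c)) x = gradient φ (x + c) := by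
  simp only [gradient, fderiv_comp_add_right]

theorem Lop_comp_add_const (φ : RE N → ℝ) (c x : RE N) :
    Lop μ₁ μ₂ j₁ j₂ (fun y => φ (y + c)) x = Lop μ₁ μ₂ j₁ j₂ φ (x + c) := by
  unfold Lop
  simp only [gradient_comp_add_const, add_right_comm]

theorem TestFn.comp_add_const {φ : RE N → ℝ} (hφ : TestFn φ) (c : RE N) :
    TestFn fun y => φ (y + c) := by
  obtain ⟨h, B, hB⟩ := hφ
  exact ⟨h.comp (contDiff_id.add contDiff_const), B, fun y => hB _⟩

theorem exists_sup_convolution_argmax {u : RE N → ℝ} (hu : Continuous u) (hb : Bdd u) {c : ℝ}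
    (hc : 0 < c) (x : RE N) :
    ∃ x', ∀ y, u y - c * ‖x - y‖ ^ 2 ≤ u x' - c * ‖x - x'‖ ^ 2 := by
  obtain ⟨B, hB⟩ := hb
  refine Continuous.exists_forall_ge' (by fun_prop) x ?_
  have h1 : Tendsto (fun y : RE N => ‖x - y‖) (cocompact _) atTop := by
    have := tendsto_norm_cocompact_atTop (E := RE N)
    exact this.comp (Homeomorph.subLeft x).isClosedEmbedding.tendsto_cocompact
  have h2 : Tendsto (fun y : RE N => c * ‖x - y‖ ^ 2) (cocompact _) atTop :=
    ((tendsto_pow_atTop two_ne_zero).comp h1).const_mul_atTop hc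
  filter_upwards [h2.eventually_ge_atTop (2 * B)] with y hy
  have h3 := abs_le.1 (hB y)
  have h4 := abs_le.1 (hB x)
  simp only [sub_self, norm_zero]
  linarith

/-- Regularization of a subsolution by sup-convolution. -/
theorem IsSubSol.exists_regularization
    (hF2 : ∀ (a b : ℝ) (p : RE N) (l : ℝ), b ≤ a → F b p l ≤ F a p l)
    (hf : UniformContinuous f) {u : RE N → ℝ} (hu : UniformContinuous u) (hb : Bdd u)
    (hsub : IsSubSol μ₁ μ₂ j₁ j₂ F f u) {a : ℝ} (ha : 0 < a) :
    ∃ (U : RE N → ℝ) (c R : ℝ), 0 < c ∧ UniformContinuous U ∧ Bdd U ∧ (∀ x, u x ≤ U x) ∧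
      IsSubSol μ₁ μ₂ j₁ j₂ F (fun x => f x + a) U ∧
      ∀ x, ∃ p, ‖p‖ ≤ R ∧ ∀ h, U x + ⟪h, p⟫_ℝ - c * ‖h‖ ^ 2 ≤ U (x + h) := by
  obtain ⟨ρ, hρ, hfρ⟩ := Metric.uniformContinuous_iff.1 hf a ha
  obtain ⟨B, hB⟩ := id hb
  have hB0 : 0 ≤ B := (abs_nonneg _).trans (hB 0)
  set c : ℝ := (2 * B + 1) / ρ ^ 2 with hc
  have hc0 : 0 < c := by positivity
  have hcρ : c * ρ ^ 2 = 2 * B + 1 := by rw [hc]; field_simp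
  choose Y hY using exists_sup_convolution_argmax hu.continuous hb hc0
  have hdist : ∀ x, ‖x - Y x‖ < ρ := by
    intro x
    have h1 := hY x x
    simp only [sub_self, norm_zero] at h1
    have h2 := abs_le.1 (hB x)
    have h3 := abs_le.1 (hB (Y x))
    have h4 : c * ‖x - Y x‖ ^ 2 < c * ρ ^ 2 := by rw [hcρ]; linarith
    exact lt_of_pow_lt_pow_left₀ 2 hρ.le (lt_of_mul_lt_mul_left h4 hc0.le)
  refine ⟨fun x => u (Y x) - c * ‖x - Y x‖ ^ 2, c, 2 * c * ρ, hc0, ?_, ⟨B, ?_⟩, ?_, ?_, ?_⟩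
  · rw [Metric.uniformContinuous_iff] at hu ⊢
    intro e he
    obtain ⟨d, hd, h⟩ := hu (e / 2) (by positivity)
    refine ⟨d, hd, ?_⟩
    have key : ∀ x y : RE N, dist x y < d →
        u (Y x) - c * ‖x - Y x‖ ^ 2 - e / 2 ≤ u (Y y) - c * ‖y - Y y‖ ^ 2 := by
      intro x y hxy
      have h1 := hY y (Y x + (y - x))
      have h2 : dist (Y x) (Y x + (y - x)) < d := by
        rwa [dist_eq_norm, sub_add_cancel_left, neg_sub, ← dist_eq_norm]
      have h3 := h h2
      rw [Real.dist_eq, abs_lt] at h3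
      have h4 : y - (Y x + (y - x)) = x - Y x := by abel
      rw [h4] at h1
      linarith
    intro x y hxy
    rw [Real.dist_eq, abs_lt]
    have h1 := key x y hxy
    have h2 := key y x (by rwa [dist_comm])
    constructor <;> linarith
  · intro x
    have h1 := hY x x
    simp only [sub_self, norm_zero] at h1
    have h2 := abs_le.1 (hB x)
    have h3 := abs_le.1 (hB (Y x))
    have h4 : 0 ≤ c * ‖x - Y x‖ ^ 2 := by positivity
    rw [abs_le]
    constructor <;> linarith
  · intro x
    have h1 := hY x x
    simp only [sub_self, norm_zero] at h1
    linarith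
  · intro φ hφ x hx
    have e : Y x + (x - Y x) = x := by abel
    have h1 := hsub _ (hφ.comp_add_const (x - Y x)) (Y x) fun y => by
      have h2 := hx (y + (x - Y x))
      have h3 := hY (y + (x - Y x)) y
      rw [add_sub_cancel_left] at h3
      simp only at h2
      rw [e]
      linarith
    rw [Lop_comp_add_const, gradient_comp_add_const, e] at h1
    have h2 : dist (Y x) x < ρ := by rw [dist_comm, dist_eq_norm]; exact hdist x
    have h3 := hfρ h2
    rw [Real.dist_eq, abs_lt] at h3
    have h4 : u (Y x) - c * ‖x - Y x‖ ^ 2 ≤ u (Y x) := by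
      have : 0 ≤ c * ‖x - Y x‖ ^ 2 := by positivity
      linarith
    have h5 := hF2 _ _ (gradient φ x) (Lop μ₁ μ₂ j₁ j₂ φ x) h4
    linarith
  · intro x
    refine ⟨(-(2 * c)) • (x - Y x), ?_, fun h => ?_⟩
    · rw [norm_smul, norm_neg, Real.norm_of_nonneg (by positivity)]
      have := hdist x
      gcongr
    · have h1 := hY (x + h) (Y x)
      have h2 : x + h - Y x = (x - Y x) + h := by abel
      rw [h2, norm_add_sq_real] at h1
      rw [inner_smul_right, real_inner_comm]
      linarith

/-- Regularization of a supersolution by inf-convolution. -/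
theorem IsSuperSol.exists_regularization
    (hF2 : ∀ (a b : ℝ) (p : RE N) (l : ℝ), b ≤ a → F b p l ≤ F a p l)
    (hf : UniformContinuous f) {v : RE N → ℝ} (hv : UniformContinuous v) (hb : Bdd v)
    (hsuper : IsSuperSol μ₁ μ₂ j₁ j₂ F f v) {a : ℝ} (ha : 0 < a) :
    ∃ (V : RE N → ℝ) (c R : ℝ), 0 < c ∧ UniformContinuous V ∧ Bdd V ∧ (∀ x, V x ≤ v x) ∧
      IsSuperSol μ₁ μ₂ j₁ j₂ F (fun x => f x - a) V ∧
      ∀ x, ∃ p, ‖p‖ ≤ R ∧ ∀ h, V (x + h) ≤ V x + ⟪h, p⟫_ℝ + c * ‖h‖ ^ 2 := by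
  have hF2' : ∀ (a b : ℝ) (p : RE N) (l : ℝ), b ≤ a → -F (-b) (-p) (-l) ≤ -F (-a) (-p) (-l) :=
    fun a b p l hab => neg_le_neg (hF2 _ _ _ _ (neg_le_neg hab))
  obtain ⟨U, c, R, hc, hU, hUb, hvU, hUs, hUp⟩ := hsuper.neg.exists_regularization
    hF2' hf.neg hv.neg hb.neg ha
  refine ⟨fun x => -U x, c, R, hc, hU.neg, hUb.neg, fun x => by linarith [hvU x], ?_, fun x => ?_⟩
  · have h := hUs.neg
    simp only [neg_neg, neg_add] at h
    simpa only [sub_eq_add_neg] using h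
  · obtain ⟨p, hp, h⟩ := hUp x
    refine ⟨-p, by rwa [norm_neg], fun y => ?_⟩
    rw [inner_neg_right]
    linarith [h y]

end SupConvolution

section Comparison

variable {N P : ℕ} {μ₁ μ₂ : Measure (RE P)} {j₁ j₂ : RE N → RE P → RE N}
  {F : ℝ → RE N → ℝ → ℝ} {f : RE N → ℝ}

/-- Existence of a maximum point of a slightly penalized difference `U - V`, close to the
supremum. -/
theorem exists_penalized_max_s5 {U V : RE N → ℝ} (hU : Continuous U) (hV : Continuous V)
    (hUb : Bdd U) (hVb : Bdd V) (x₀ : RE N) {δ : ℝ} (hδ : 0 < δ) :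
    ∃ y x : RE N, U x₀ - V x₀ - δ ≤ U x - V x ∧
      ∀ z, U z - V z - 2 * δ * well (z - y) ≤ U x - V x - 2 * δ * well (x - y) := by
  obtain ⟨A, hA⟩ := hUb
  obtain ⟨B, hB⟩ := hVb
  have hbd : BddAbove (Set.range fun z => U z - V z) := by
    refine ⟨A + B, ?_⟩
    rintro _ ⟨z, rfl⟩
    have h1 := abs_le.1 (hA z)
    have h2 := abs_le.1 (hB z)
    simp only
    linarith
  set S := sSup (Set.range fun z => U z - V z) with hS
  have hle : ∀ z, U z - V z ≤ S := fun z => le_csSup hbd ⟨z, rfl⟩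
  obtain ⟨_, ⟨y, rfl⟩, hy⟩ := exists_lt_of_lt_csSup (Set.range_nonempty fun z => U z - V z)
    (show S - δ < S by linarith)
  simp only at hy
  have hw : Continuous (well : RE N → ℝ) := (contDiff_well (n := 0)).continuous
  obtain ⟨x, hx⟩ := Continuous.exists_forall_ge'
    (f := fun z => U z - V z - 2 * δ * well (z - y)) (by fun_prop) y (by
      have h1 : Tendsto (fun z : RE N => ‖z - y‖) (cocompact _) atTop :=
        (tendsto_norm_cocompact_atTop (E := RE N)).comp
          (Homeomorph.subRight y).isClosedEmbedding.tendsto_cocompact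
      filter_upwards [h1.eventually_ge_atTop 1] with z hz
      have h2 := well_ge zero_le_one hz
      simp only [sub_self, well_zero]
      have h3 : 2 * δ * (1 ^ 2 / (1 + 1 ^ 2)) ≤ 2 * δ * well (z - y) := by gcongr
      norm_num at h3
      linarith [hle z])
  refine ⟨y, x, ?_, hx⟩
  have h1 := hx y
  simp only [sub_self, well_zero] at h1
  have h2 : 0 ≤ 2 * δ * well (x - y) := mul_nonneg (by positivity) (well_nonneg _)
  linarith [hle x₀]

/-- At a penalized maximum point of `U - V`, where `U` is semiconvex and `V` semiconcave, both
functions have a quadratic approximation. -/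
theorem exists_quadBound_of_penalized_max {U V : RE N → ℝ} {c c' : ℝ} (hc : 0 ≤ c) (hc' : 0 ≤ c')
    {δ : ℝ} (hδ : 0 < δ) (hδ1 : δ ≤ 1) {x y p q : RE N}
    (hp : ∀ h, U x + ⟪h, p⟫_ℝ - c * ‖h‖ ^ 2 ≤ U (x + h))
    (hq : ∀ h, V (x + h) ≤ V x + ⟪h, q⟫_ℝ + c' * ‖h‖ ^ 2)
    (hmax : ∀ z, U z - V z - 2 * δ * well (z - y) ≤ U x - V x - 2 * δ * well (x - y)) :
    ‖p - q‖ ≤ 4 * δ ∧ QuadBound U x p (c + c' + 16) ∧ QuadBound V x q (c + c' + 16) ∧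
      (∀ h, U (x + h) - U x - ⟪h, p⟫_ℝ ≤ V (x + h) - V x - ⟪h, q⟫_ℝ + 16 * δ * ‖h‖ ^ 2) ∧
      ∀ h, U (x + h) - U x ≤ V (x + h) - V x + 2 * δ := by
  have hmax' : ∀ h, U (x + h) - U x ≤
      V (x + h) - V x + 2 * δ * (well (x - y + h) - well (x - y)) := by
    intro h
    have := hmax (x + h)
    rw [add_sub_right_comm] at this
    linarith
  have hw : ∀ h, well (x - y + h) - well (x - y) ≤
      ⟪h, wellGrad (x - y)⟫_ℝ + 8 * ‖h‖ ^ 2 := by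
    intro h
    have := (abs_le.1 (quadBound_well (x - y) h)).2
    linarith
  have hw' : ∀ h, U (x + h) - U x ≤
      V (x + h) - V x + (⟪h, (2 * δ) • wellGrad (x - y)⟫_ℝ + 16 * δ * ‖h‖ ^ 2) := by
    intro h
    have := mul_le_mul_of_nonneg_left (hw h) (show 0 ≤ 2 * δ by positivity)
    rw [inner_smul_right]
    linarith [hmax' h]
  have hpq : p = q + (2 * δ) • wellGrad (x - y) := by
    refine eq_of_forall_inner_le_sq (C := c + c' + 16 * δ) fun h => ?_
    rw [inner_add_right]
    linarith [hw' h, hp h, hq h]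
  have hkey : ∀ h, U (x + h) - U x - ⟪h, p⟫_ℝ ≤
      V (x + h) - V x - ⟪h, q⟫_ℝ + 16 * δ * ‖h‖ ^ 2 := by
    intro h
    rw [hpq, inner_add_right]
    linarith [hw' h]
  have hsq : ∀ h : RE N, 16 * δ * ‖h‖ ^ 2 ≤ 16 * ‖h‖ ^ 2 := by
    intro h
    gcongr
    linarith
  refine ⟨?_, fun h => ?_, fun h => ?_, hkey, fun h => ?_⟩
  · rw [hpq, add_sub_cancel_left, norm_smul, Real.norm_of_nonneg (by positivity)]
    nlinarith [norm_wellGrad_le (x - y)]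
  · have h1 : 0 ≤ c * ‖h‖ ^ 2 := by positivity
    have h2 : 0 ≤ c' * ‖h‖ ^ 2 := by positivity
    rw [abs_le]
    constructor <;> nlinarith [hkey h, hp h, hq h, hsq h, sq_nonneg ‖h‖]
  · have h1 : 0 ≤ c * ‖h‖ ^ 2 := by positivity
    have h2 : 0 ≤ c' * ‖h‖ ^ 2 := by positivity
    rw [abs_le]
    constructor <;> nlinarith [hkey h, hp h, hq h, hsq h, sq_nonneg ‖h‖]
  · have h1 := hmax' h
    have h2 : 2 * δ * (well (x - y + h) - well (x - y)) ≤ 2 * δ * 1 := by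
      gcongr
      linarith [well_le_one (x - y + h), well_nonneg (x - y)]
    linarith

theorem JumpHyp.abs_Lam_le (H : JumpHyp μ₁ μ₂ j₁ j₂) {u : RE N → ℝ} {B : ℝ}
    (hB : ∀ y, |u y| ≤ B) {x p : RE N} {C : ℝ} (hQ : QuadBound u x p C) :
    |Lam μ₁ μ₂ j₁ j₂ u x p| ≤ C * ∫ z, ‖j₁ p z‖ ^ 2 ∂μ₁ + 2 * B * μ₂.real Set.univ := by
  have := H.fin
  refine (abs_add_le _ _).trans (add_le_add ?_ ?_)
  · rw [← integral_const_mul, ← Real.norm_eq_abs]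
    exact norm_integral_le_of_norm_le ((H.int₁ p).const_mul C) (Eventually.of_forall fun z => hQ _)
  · rw [← Real.norm_eq_abs]
    refine norm_integral_le_of_norm_le_const (Eventually.of_forall fun z => ?_)
    have h1 := abs_sub (u (x + j₂ p z)) (u x)
    have h2 := hB (x + j₂ p z)
    have h3 := hB x
    rw [Real.norm_eq_abs]
    linarith

/-- Comparison of the nonlocal terms of `U` and `V` at a penalized maximum point of `U - V`. -/
theorem JumpHyp.Lam_le_Lam_add (H : JumpHyp μ₁ μ₂ j₁ j₂) {U V : RE N → ℝ} (hU : Continuous U)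
    (hV : Continuous V) (hUb : Bdd U) (hVb : Bdd V) {x p q : RE N} {C δ : ℝ}
    (hQU : QuadBound U x p C) (hQV : QuadBound V x q C)
    (h₁ : ∀ h, U (x + h) - U x - ⟪h, p⟫_ℝ ≤ V (x + h) - V x - ⟪h, q⟫_ℝ + 16 * δ * ‖h‖ ^ 2)
    (h₂ : ∀ h, U (x + h) - U x ≤ V (x + h) - V x + 2 * δ) :
    Lam μ₁ μ₂ j₁ j₂ U x p ≤ Lam μ₁ μ₂ j₁ j₂ V x q
      + (16 * δ * (∫ z, ‖j₁ p z‖ ^ 2 ∂μ₁)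
        + (∫ z, ((V (x + j₁ p z) - V x - ⟪j₁ p z, q⟫_ℝ)
            - (V (x + j₁ q z) - V x - ⟪j₁ q z, q⟫_ℝ)) ∂μ₁)
        + 2 * δ * μ₂.real Set.univ
        + ∫ z, ((V (x + j₂ p z) - V x) - (V (x + j₂ q z) - V x)) ∂μ₂) := by
  have := H.fin
  have hVp := H.integrable₁ hV hQV p
  have hVq := H.integrable₁ hV hQV q
  have hVp2 := H.integrable₂ hV hVb x p
  have hVq2 := H.integrable₂ hV hVb x q
  have e1 : ∫ z, (U (x + j₁ p z) - U x - ⟪j₁ p z, p⟫_ℝ) ∂μ₁ ≤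
      ∫ z, ((V (x + j₁ p z) - V x - ⟪j₁ p z, q⟫_ℝ) + 16 * δ * ‖j₁ p z‖ ^ 2) ∂μ₁ :=
    integral_mono (H.integrable₁ hU hQU p) (hVp.add ((H.int₁ p).const_mul _)) fun z => h₁ _
  have e2 : ∫ z, (U (x + j₂ p z) - U x) ∂μ₂ ≤ ∫ z, ((V (x + j₂ p z) - V x) + 2 * δ) ∂μ₂ :=
    integral_mono (H.integrable₂ hU hUb x p) (hVp2.add (integrable_const _)) fun z => h₂ _
  rw [integral_add hVp ((H.int₁ p).const_mul _), integral_const_mul] at e1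
  rw [integral_add hVp2 (integrable_const _), integral_const, smul_eq_mul] at e2
  rw [integral_sub hVp hVq, integral_sub hVp2 hVq2]
  unfold Lam
  linarith

theorem tendsto_sub_of_uniformContinuous {ι : Type*} {l : Filter ι} {V : RE N → ℝ}
    (hV : UniformContinuous V) {x a b : ι → RE N} {c : RE N} (ha : Tendsto a l (𝓝 c))
    (hb : Tendsto b l (𝓝 c)) :
    Tendsto (fun n => V (x n + a n) - V (x n + b n)) l (𝓝 0) := by
  have hab : Tendsto (fun n => a n - b n) l (𝓝 0) := by simpa using ha.sub hb
  rw [Metric.tendsto_nhds] at hab ⊢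
  intro e he
  obtain ⟨d, hd, h⟩ := Metric.uniformContinuous_iff.1 hV e he
  filter_upwards [hab d hd] with n hn
  have := h (a := x n + a n) (b := x n + b n) (by
    rwa [dist_add_left, dist_eq_norm, ← dist_zero_right])
  rw [Real.dist_eq] at this ⊢
  rwa [sub_zero]

/-- Comparison of a semiconvex subsolution with a semiconcave supersolution. -/
theorem comparison_of_semiconvex (H : JumpHyp μ₁ μ₂ j₁ j₂)
    (hF : Continuous fun t : ℝ × RE N × ℝ => F t.1 t.2.1 t.2.2)
    (hFm : ∀ (r : ℝ) (p : RE N) (l l' : ℝ), l ≤ l' → F r p l' ≤ F r p l)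
    {γ : ℝ} (hF2 : ∀ (a b : ℝ) (p : RE N) (l : ℝ), b ≤ a → γ * (a - b) ≤ F a p l - F b p l)
    (hγ : 0 < γ) (hfb : Bdd f) {a : ℝ} (ha : 0 ≤ a) {U V : RE N → ℝ} (hU : UniformContinuous U)
    (hV : UniformContinuous V) (hUb : Bdd U) (hVb : Bdd V)
    (hUs : IsSubSol μ₁ μ₂ j₁ j₂ F (fun x => f x + a) U)
    (hVs : IsSuperSol μ₁ μ₂ j₁ j₂ F (fun x => f x - a) V) {c c' R R' : ℝ} (hc : 0 ≤ c)
    (hc' : 0 ≤ c') (hUp : ∀ x, ∃ p, ‖p‖ ≤ R ∧ ∀ h, U x + ⟪h, p⟫_ℝ - c * ‖h‖ ^ 2 ≤ U (x + h))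
    (hVp : ∀ x, ∃ p, ‖p‖ ≤ R' ∧ ∀ h, V (x + h) ≤ V x + ⟪h, p⟫_ℝ + c' * ‖h‖ ^ 2) (x₀ : RE N) :
    γ * (U x₀ - V x₀) ≤ 2 * a := by
  by_cases hpos : U x₀ - V x₀ ≤ 0
  · nlinarith
  push Not at hpos
  choose P hPR hP using hUp
  choose Q hQR hQ using hVp
  obtain ⟨A, hA⟩ := id hUb
  obtain ⟨B, hB⟩ := id hVb
  obtain ⟨K, hK⟩ := id hfb
  set δ : ℕ → ℝ := fun n => 1 / ((n : ℝ) + 1) with hδdef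
  have hδ : ∀ n, 0 < δ n := fun n => by positivity
  have hδ1 : ∀ n, δ n ≤ 1 := fun n => by
    rw [hδdef]
    simp only
    rw [div_le_one (by positivity)]
    linarith [n.cast_nonneg (α := ℝ)]
  have hδ0 : Tendsto δ atTop (𝓝 0) := tendsto_one_div_add_atTop_nhds_zero_nat
  choose y x hx hmax using fun n =>
    exists_penalized_max_s5 hU.continuous hV.continuous hUb hVb x₀ (hδ n)
  set C := c + c' + 16 with hC
  have hC0 : 0 ≤ C := by positivity
  have hquad := fun n => exists_quadBound_of_penalized_max hc hc' (hδ n) (hδ1 n) (hP (x n))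
    (hQ (x n)) (hmax n)
  obtain ⟨J, hJ⟩ := H.bdd₁ (max R R')
  have hPJ : ∀ n, ∫ z, ‖j₁ (P (x n)) z‖ ^ 2 ∂μ₁ ≤ J :=
    fun n => hJ _ ((hPR _).trans (le_max_left _ _))
  have hQJ : ∀ n, ∫ z, ‖j₁ (Q (x n)) z‖ ^ 2 ∂μ₁ ≤ J :=
    fun n => hJ _ ((hQR _).trans (le_max_right _ _))
  have hℓ : ∀ n, |Lam μ₁ μ₂ j₁ j₂ U (x n) (P (x n))| ≤ C * J + 2 * A * μ₂.real Set.univ := by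
    intro n
    have h1 := H.abs_Lam_le hA (hquad n).2.1
    have h2 := mul_le_mul_of_nonneg_left (hPJ n) hC0
    linarith
  have hm : ∀ n, |Lam μ₁ μ₂ j₁ j₂ V (x n) (Q (x n))| ≤ C * J + 2 * B * μ₂.real Set.univ := by
    intro n
    have h1 := H.abs_Lam_le hB (hquad n).2.2.1
    have h2 := mul_le_mul_of_nonneg_left (hQJ n) hC0
    linarith
  obtain ⟨⟨u', v', q', ℓ', m', f'⟩, -, σ, hσ, hlim⟩ :=
    ((isCompact_Icc (a := -A) (b := A)).prod ((isCompact_Icc (a := -B) (b := B)).prod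
      ((isCompact_closedBall (0 : RE N) R').prod
        ((isCompact_Icc (a := -(C * J + 2 * A * μ₂.real Set.univ))
          (b := C * J + 2 * A * μ₂.real Set.univ)).prod
          ((isCompact_Icc (a := -(C * J + 2 * B * μ₂.real Set.univ))
            (b := C * J + 2 * B * μ₂.real Set.univ)).prod
            (isCompact_Icc (a := -K) (b := K))))))).tendsto_subseq
      (x := fun n => (U (x n), V (x n), Q (x n), Lam μ₁ μ₂ j₁ j₂ U (x n) (P (x n)),
        Lam μ₁ μ₂ j₁ j₂ V (x n) (Q (x n)), f (x n)))
      (fun n => ⟨abs_le.1 (hA _), abs_le.1 (hB _), by simpa using hQR (x n),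
        abs_le.1 (hℓ n), abs_le.1 (hm n), abs_le.1 (hK _)⟩)
  simp only [nhds_prod_eq, tendsto_prod_iff'] at hlim
  obtain ⟨hu', hv', hq', hℓ', hm', hf'⟩ := hlim
  simp only [Function.comp_def] at hu' hv' hq' hℓ' hm' hf'
  have hδσ : Tendsto (fun n => δ (σ n)) atTop (𝓝 0) := hδ0.comp hσ.tendsto_atTop
  have hp' : Tendsto (fun n => P (x (σ n))) atTop (𝓝 q') := by
    have h1 : Tendsto (fun n => P (x (σ n)) - Q (x (σ n))) atTop (𝓝 0) := by
      refine squeeze_zero_norm (fun n => (hquad (σ n)).1) ?_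
      simpa using hδσ.const_mul 4
    simpa using h1.add hq'
  have hV1 : Tendsto (fun n => ∫ z, ((V (x (σ n) + j₁ (P (x (σ n))) z) - V (x (σ n))
        - ⟪j₁ (P (x (σ n))) z, Q (x (σ n))⟫_ℝ)
      - (V (x (σ n) + j₁ (Q (x (σ n))) z) - V (x (σ n))
        - ⟪j₁ (Q (x (σ n))) z, Q (x (σ n))⟫_ℝ)) ∂μ₁) atTop (𝓝 0) := by
    have h0 : (0 : ℝ) = ∫ _z, (0 : ℝ) ∂μ₁ := by simp
    rw [h0]
    refine H.tendsto_integral₁ hp' hq' hC0 (fun n => ?_) (Eventually.of_forall fun n z => ?_) ?_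
    · exact (H.integrable₁ hV.continuous (hquad (σ n)).2.2.1 _).1.sub
        (H.integrable₁ hV.continuous (hquad (σ n)).2.2.1 _).1
    · refine (abs_sub _ _).trans ?_
      rw [mul_add]
      exact add_le_add ((hquad (σ n)).2.2.1 _) ((hquad (σ n)).2.2.1 _)
    · filter_upwards [H.cont₁] with z hz
      have h1 := (hz.tendsto q').comp hp'
      have h2 := (hz.tendsto q').comp hq'
      have h3 := (tendsto_sub_of_uniformContinuous hV (x := fun n => x (σ n)) h1 h2).sub
        ((h1.inner hq').sub (h2.inner hq'))
      simp only [sub_self] at h3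
      refine h3.congr fun n => ?_
      simp only [Function.comp_apply]
      ring
  have hV2 : Tendsto (fun n => ∫ z, ((V (x (σ n) + j₂ (P (x (σ n))) z) - V (x (σ n)))
      - (V (x (σ n) + j₂ (Q (x (σ n))) z) - V (x (σ n)))) ∂μ₂) atTop (𝓝 0) := by
    have := H.fin
    have h0 : (0 : ℝ) = ∫ _z, (0 : ℝ) ∂μ₂ := by simp
    rw [h0]
    refine tendsto_integral_filter_of_dominated_convergence (fun _ => 2 * B)
      (Eventually.of_forall fun n => ?_) (Eventually.of_forall fun n => Eventually.of_forall
      fun z => ?_) (integrable_const _) ?_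
    · exact (H.integrable₂ hV.continuous hVb _ _).1.sub (H.integrable₂ hV.continuous hVb _ _).1
    · have h1 := abs_le.1 (hB (x (σ n) + j₂ (P (x (σ n))) z))
      have h2 := abs_le.1 (hB (x (σ n) + j₂ (Q (x (σ n))) z))
      rw [Real.norm_eq_abs, abs_le]
      constructor <;> linarith
    · filter_upwards [H.cont₂] with z hz
      have h3 := tendsto_sub_of_uniformContinuous hV (x := fun n => x (σ n))
        ((hz.tendsto q').comp hp') ((hz.tendsto q').comp hq')
      refine h3.congr fun n => ?_
      simp only [Function.comp_apply]
      ring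
  have hJlim : Tendsto (fun n => 16 * δ (σ n) * ∫ z, ‖j₁ (P (x (σ n))) z‖ ^ 2 ∂μ₁) atTop
      (𝓝 0) := by
    refine squeeze_zero (g := fun n => 16 * δ (σ n) * J)
      (fun n => mul_nonneg (by linarith [hδ (σ n)]) (integral_nonneg fun z => by positivity))
      (fun n => mul_le_mul_of_nonneg_left (hPJ _) (by linarith [hδ (σ n)])) ?_
    simpa using (hδσ.const_mul 16).mul_const J
  have hℓm : ℓ' ≤ m' := by
    have h1 := hm'.add (((hJlim.add hV1).add
      ((hδσ.const_mul 2).mul_const (μ₂.real Set.univ))).add hV2)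
    simp only [mul_zero, zero_mul, add_zero] at h1
    refine le_of_tendsto_of_tendsto' hℓ' h1 fun n => ?_
    exact H.Lam_le_Lam_add hU.continuous hV.continuous hUb hVb (hquad (σ n)).2.1
      (hquad (σ n)).2.2.1 (hquad (σ n)).2.2.2.1 (hquad (σ n)).2.2.2.2
  have hUF : F u' q' ℓ' ≤ f' + a :=
    le_of_tendsto_of_tendsto'
      ((hF.tendsto (u', q', ℓ')).comp (hu'.prodMk_nhds (hp'.prodMk_nhds hℓ')))
      (hf'.add_const a) fun n =>
        hUs.le_of_quadBound H hF hU.continuous hUb hC0 (hquad (σ n)).2.1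
  have hVF : f' - a ≤ F v' q' m' :=
    le_of_tendsto_of_tendsto' (hf'.sub_const a)
      ((hF.tendsto (v', q', m')).comp (hv'.prodMk_nhds (hq'.prodMk_nhds hm'))) fun n =>
        hVs.le_of_quadBound H hF hV.continuous hVb hC0 (hquad (σ n)).2.2.1
  have huv : U x₀ - V x₀ ≤ u' - v' := by
    have h1 := hδσ.const_sub (U x₀ - V x₀)
    rw [sub_zero] at h1
    exact le_of_tendsto_of_tendsto' h1 (hu'.sub hv') fun n => hx (σ n)
  have h1 := hF2 u' v' q' ℓ' (by linarith)
  have h2 := hFm v' q' ℓ' m' hℓm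
  have h3 := mul_le_mul_of_nonneg_left huv hγ.le
  linarith

/-- Comparison principle for bounded uniformly continuous sub- and supersolutions. -/
theorem comparison (H : JumpHyp μ₁ μ₂ j₁ j₂)
    (hF : Continuous fun t : ℝ × RE N × ℝ => F t.1 t.2.1 t.2.2)
    (hFm : ∀ (r : ℝ) (p : RE N) (l l' : ℝ), l ≤ l' → F r p l' ≤ F r p l)
    {γ : ℝ} (hF2 : ∀ (a b : ℝ) (p : RE N) (l : ℝ), b ≤ a → γ * (a - b) ≤ F a p l - F b p l)
    (hγ : 0 < γ) (hf : UniformContinuous f) (hfb : Bdd f) {u v : RE N → ℝ}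
    (hu : UniformContinuous u) (hv : UniformContinuous v) (hub : Bdd u) (hvb : Bdd v)
    (hus : IsSubSol μ₁ μ₂ j₁ j₂ F f u) (hvs : IsSuperSol μ₁ μ₂ j₁ j₂ F f v) (x : RE N) :
    u x ≤ v x := by
  have hmono : ∀ (a b : ℝ) (p : RE N) (l : ℝ), b ≤ a → F b p l ≤ F a p l := fun a b p l hab => by
    have h1 := hF2 a b p l hab
    have h2 : 0 ≤ γ * (a - b) := mul_nonneg hγ.le (by linarith)
    linarith
  have key : ∀ a > 0, γ * (u x - v x) ≤ 2 * a := by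
    intro a ha
    obtain ⟨U, c, R, hc, hU, hUb, huU, hUs, hUp⟩ :=
      hus.exists_regularization hmono hf hu hub ha
    obtain ⟨V, c', R', hc', hV, hVb, hVv, hVs, hVp⟩ :=
      hvs.exists_regularization hmono hf hv hvb ha
    have h1 := comparison_of_semiconvex H hF hFm hF2 hγ hfb ha.le hU hV hUb hVb hUs hVs hc.le
      hc'.le hUp hVp x
    have h2 : γ * (u x - v x) ≤ γ * (U x - V x) := by
      gcongr
      · exact huU x
      · exact hVv x
    linarith
  by_contra! hlt
  have h1 : 0 < γ * (u x - v x) := mul_pos hγ (by linarith)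
  have h2 := key (γ * (u x - v x) / 4) (by positivity)
  linarith

end Comparison

section Perron

variable {N P : ℕ} {μ₁ μ₂ : Measure (RE P)} {j₁ j₂ : RE N → RE P → RE N}
  {F : ℝ → RE N → ℝ → ℝ} {f : RE N → ℝ}

/-- Ordering of the nonlocal operator at a maximum point of a difference of test functions. -/
theorem JumpHyp.Lop_le_Lop (H : JumpHyp μ₁ μ₂ j₁ j₂) {φ ψ : RE N → ℝ} (hφ : TestFn φ)
    (hψ : TestFn ψ) {x : RE N} (h : ∀ y, φ y - ψ y ≤ φ x - ψ x) :
    gradient φ x = gradient ψ x ∧ Lop μ₁ μ₂ j₁ j₂ φ x ≤ Lop μ₁ μ₂ j₁ j₂ ψ x := by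
  have hg := gradient_eq_of_forall_sub_le (hφ.differentiableAt x) (hψ.differentiableAt x) h
  refine ⟨hg, ?_⟩
  obtain ⟨C, -, hQ⟩ := hφ.quadBound x
  obtain ⟨C', -, hQ'⟩ := hψ.quadBound x
  have hcφ := hφ.1.continuous
  have hcψ := hψ.1.continuous
  rw [Lop_eq_Lam, Lop_eq_Lam, hg]
  rw [hg] at hQ
  refine add_le_add (integral_mono (H.integrable₁ hcφ hQ _) (H.integrable₁ hcψ hQ' _) fun z => ?_)
    (integral_mono (H.integrable₂ hcφ hφ.2 _ _) (H.integrable₂ hcψ hψ.2 _ _) fun z => ?_)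
  · have := h (x + j₁ (gradient ψ x) z)
    simp only
    linarith
  · have := h (x + j₂ (gradient ψ x) z)
    simp only
    linarith

theorem testFn_const (c : ℝ) : TestFn fun _ : RE N => c :=
  ⟨contDiff_const, |c|, fun _ => le_rfl⟩

theorem gradient_const_eq_zero (c : ℝ) (x : RE N) : gradient (fun _ : RE N => c) x = 0 :=
  (QuadBound.gradient_eq (C := 0) fun h => by simp)

theorem Lop_const (c : ℝ) (x : RE N) : Lop μ₁ μ₂ j₁ j₂ (fun _ => c) x = 0 := by
  simp [Lop, gradient_const_eq_zero]

theorem isSubSol_const (H : JumpHyp μ₁ μ₂ j₁ j₂)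
    (hFm : ∀ (r : ℝ) (p : RE N) (l l' : ℝ), l ≤ l' → F r p l' ≤ F r p l) {c : ℝ}
    (hc : ∀ x, F c 0 0 ≤ f x) : IsSubSol μ₁ μ₂ j₁ j₂ F f fun _ => c := by
  intro φ hφ x hx
  obtain ⟨hg, hL⟩ := H.Lop_le_Lop (testFn_const c) hφ hx
  rw [gradient_const_eq_zero] at hg
  rw [Lop_const] at hL
  rw [← hg]
  exact (hFm _ _ _ _ hL).trans (hc x)

theorem isSuperSol_const (H : JumpHyp μ₁ μ₂ j₁ j₂)
    (hFm : ∀ (r : ℝ) (p : RE N) (l l' : ℝ), l ≤ l' → F r p l' ≤ F r p l) {c : ℝ}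
    (hc : ∀ x, f x ≤ F c 0 0) : IsSuperSol μ₁ μ₂ j₁ j₂ F f fun _ => c := by
  intro φ hφ x hx
  obtain ⟨hg, hL⟩ := H.Lop_le_Lop (x := x) hφ (testFn_const c) fun y => by linarith [hx y]
  rw [gradient_const_eq_zero] at hg
  rw [Lop_const] at hL
  rw [hg]
  exact (hc x).trans (hFm _ _ _ _ hL)

/-- Adding a multiple of the well centred at `x₀` to a test function preserves the gradient
at `x₀` and changes the nonlocal operator linearly. -/
theorem JumpHyp.exists_Lop_add_well (H : JumpHyp μ₁ μ₂ j₁ j₂) {φ : RE N → ℝ} (hφ : TestFn φ)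
    (x₀ : RE N) : ∃ k : ℝ, ∀ κ : ℝ, TestFn (fun y => φ y + κ * well (y - x₀)) ∧
      gradient (fun y => φ y + κ * well (y - x₀)) x₀ = gradient φ x₀ ∧
      Lop μ₁ μ₂ j₁ j₂ (fun y => φ y + κ * well (y - x₀)) x₀ = Lop μ₁ μ₂ j₁ j₂ φ x₀ + κ * k := by
  have hW : TestFn fun y : RE N => well (y - x₀) := by
    simpa only [sub_eq_add_neg] using testFn_well.comp_add_const (-x₀)
  have hWQ : QuadBound (fun y : RE N => well (y - x₀)) x₀ 0 8 := by
    intro h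
    have := quadBound_well (0 : RE N) h
    simpa [wellGrad_zero] using this
  obtain ⟨C, -, hQ⟩ := hφ.quadBound x₀
  have hWc := hW.1.continuous
  have hφc := hφ.1.continuous
  set p := gradient φ x₀ with hp
  refine ⟨(∫ z, (well (x₀ + j₁ p z - x₀) - well (x₀ - x₀) - ⟪j₁ p z, (0 : RE N)⟫_ℝ) ∂μ₁)
    + ∫ z, (well (x₀ + j₂ p z - x₀) - well (x₀ - x₀)) ∂μ₂, fun κ => ?_⟩
  have hg : gradient (fun y => φ y + κ * well (y - x₀)) x₀ = p := by
    refine QuadBound.gradient_eq (C := C + |κ| * 8) fun h => ?_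
    have h1 := hQ h
    have h2 := mul_le_mul_of_nonneg_left (hWQ h) (abs_nonneg κ)
    rw [← abs_mul] at h2
    have h3 := abs_add_le (φ (x₀ + h) - φ x₀ - ⟪h, p⟫_ℝ)
      (κ * (well (x₀ + h - x₀) - well (x₀ - x₀) - ⟪h, (0 : RE N)⟫_ℝ))
    rw [inner_zero_right] at h2 h3
    have e : φ (x₀ + h) + κ * well (x₀ + h - x₀) - (φ x₀ + κ * well (x₀ - x₀)) - ⟪h, p⟫_ℝ
        = (φ (x₀ + h) - φ x₀ - ⟪h, p⟫_ℝ) + κ * (well (x₀ + h - x₀) - well (x₀ - x₀) - 0) := by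
      ring
    rw [e]
    linarith
  refine ⟨⟨hφ.1.add (contDiff_const.mul hW.1), ?_⟩, hg, ?_⟩
  · obtain ⟨B, hB⟩ := hφ.2
    obtain ⟨B', hB'⟩ := hW.2
    refine ⟨B + |κ| * B', fun y => (abs_add_le _ _).trans ?_⟩
    rw [abs_mul]
    exact add_le_add (hB y) (mul_le_mul_of_nonneg_left (hB' y) (abs_nonneg κ))
  · rw [Lop_eq_Lam, Lop_eq_Lam, hg]
    have e1 := integral_add (H.integrable₁ hφc hQ p) ((H.integrable₁ hWc hWQ p).const_mul κ)
    have e2 := integral_add (H.integrable₂ hφc hφ.2 x₀ p)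
      ((H.integrable₂ hWc hW.2 x₀ p).const_mul κ)
    rw [integral_const_mul] at e1 e2
    unfold Lam
    rw [mul_add, add_add_add_comm, ← e1, ← e2]
    congr 1
    · refine integral_congr_ae (Eventually.of_forall fun z => ?_)
      simp only [inner_zero_right]
      ring
    · refine integral_congr_ae (Eventually.of_forall fun z => ?_)
      simp only
      ring

theorem norm_sq_le_two_mul_well {y : RE N} (h : well y ≤ 1 / 2) : ‖y‖ ^ 2 ≤ 2 * well y := by
  have h1 : well y * (1 + ‖y‖ ^ 2) = ‖y‖ ^ 2 := by
    unfold well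
    field_simp
  nlinarith [sq_nonneg ‖y‖]

/-- A continuous function which is at every point a supremum of subsolutions lying below it is a
subsolution. -/
theorem isSubSol_of_approx (H : JumpHyp μ₁ μ₂ j₁ j₂)
    (hF : Continuous fun t : ℝ × RE N × ℝ => F t.1 t.2.1 t.2.2) (hf : Continuous f)
    {w : RE N → ℝ} (hw : Continuous w)
    (h : ∀ x, ∀ e > 0, ∃ u, Continuous u ∧ IsSubSol μ₁ μ₂ j₁ j₂ F f u ∧ (∀ y, u y ≤ w y) ∧
      w x - e < u x) :
    IsSubSol μ₁ μ₂ j₁ j₂ F f w := by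
  intro φ hφ x₀ hx₀
  obtain ⟨k, hk⟩ := H.exists_Lop_add_well hφ x₀
  have key : ∀ κ > 0, F (w x₀) (gradient φ x₀) (Lop μ₁ μ₂ j₁ j₂ φ x₀ + κ * k) ≤ f x₀ := by
    intro κ hκ
    obtain ⟨hΦ, hg, hL⟩ := hk κ
    rw [← hg, ← hL]
    set Φ : RE N → ℝ := fun y => φ y + κ * well (y - x₀) with hΦdef
    have hΦ0 : Φ x₀ = φ x₀ := by simp [hΦdef, well_zero]
    have hΦc := hΦ.1.continuous
    have hε : ∀ n : ℕ, 0 < 1 / ((n : ℝ) + 1 + 1) := fun n => by positivity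
    have hε0 : Tendsto (fun n : ℕ => 1 / ((n : ℝ) + 1 + 1)) atTop (𝓝 0) := by
      have := (tendsto_add_atTop_iff_nat 1).2 (tendsto_one_div_add_atTop_nhds_zero_nat (𝕜 := ℝ))
      simpa using this
    have hε2 : ∀ n : ℕ, 1 / ((n : ℝ) + 1 + 1) ≤ 1 / 2 := fun n => by
      apply one_div_le_one_div_of_le two_pos
      linarith [n.cast_nonneg (α := ℝ)]
    choose u huc hus huw hux using fun n : ℕ => h x₀ (κ * (1 / ((n : ℝ) + 1 + 1)))
      (mul_pos hκ (hε n))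
    have hmax : ∀ n, ∃ x, ∀ y, u n y - Φ y ≤ u n x - Φ x := by
      intro n
      have := huc n
      refine Continuous.exists_forall_ge' (by fun_prop) x₀ ?_
      have h1 : Tendsto (fun z : RE N => ‖z - x₀‖) (cocompact _) atTop :=
        (tendsto_norm_cocompact_atTop (E := RE N)).comp
          (Homeomorph.subRight x₀).isClosedEmbedding.tendsto_cocompact
      filter_upwards [h1.eventually_ge_atTop 1] with y hy
      have h2 := mul_le_mul_of_nonneg_left (well_ge zero_le_one hy) hκ.le
      have h3 := mul_le_mul_of_nonneg_left (hε2 n) hκ.le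
      norm_num at h2
      have h4 : Φ y = φ y + κ * well (y - x₀) := rfl
      linarith [hux n, huw n y, hx₀ y]
    choose x hx using hmax
    have hwell : ∀ n, well (x n - x₀) ≤ 1 / ((n : ℝ) + 1 + 1) := by
      intro n
      have h4 : Φ (x n) = φ (x n) + κ * well (x n - x₀) := rfl
      have h5 : κ * well (x n - x₀) ≤ κ * (1 / ((n : ℝ) + 1 + 1)) := by
        linarith [hux n, huw n (x n), hx₀ (x n), hx n x₀]
      exact le_of_mul_le_mul_left h5 hκ
    have hxlim : Tendsto x atTop (𝓝 x₀) := by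
      rw [tendsto_iff_norm_sub_tendsto_zero]
      have h1 : Tendsto (fun n => ‖x n - x₀‖ ^ 2) atTop (𝓝 0) := by
        refine squeeze_zero (fun n => by positivity) (fun n =>
          (norm_sq_le_two_mul_well ((hwell n).trans (hε2 n))).trans
          (mul_le_mul_of_nonneg_left (hwell n) zero_le_two)) ?_
        simpa using hε0.const_mul 2
      have h2 := h1.sqrt
      simpa using h2
    have hulim : Tendsto (fun n => u n (x n)) atTop (𝓝 (w x₀)) := by
      have h1 : Tendsto (fun n => Φ (x n) + (w x₀ - κ * (1 / ((n : ℝ) + 1 + 1)) - Φ x₀)) atTop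
          (𝓝 (w x₀)) := by
        have := ((hΦc.tendsto x₀).comp hxlim).add
          (((hε0.const_mul κ).const_sub (w x₀)).sub_const (Φ x₀))
        simpa using this
      refine tendsto_of_tendsto_of_tendsto_of_le_of_le h1 ((hw.tendsto x₀).comp hxlim)
        (fun n => ?_) fun n => huw n _
      have := hx n x₀
      simp only
      linarith [hux n]
    refine le_of_tendsto_of_tendsto' ((hF.tendsto (w x₀, gradient Φ x₀, _)).comp
      (hulim.prodMk_nhds ((((hΦ.1.continuous_gradient (by norm_num)).tendsto x₀).comp
        hxlim).prodMk_nhds (((H.continuous_Lop hΦ).tendsto x₀).comp hxlim))))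
      ((hf.tendsto x₀).comp hxlim) fun n => hus n Φ hΦ (x n) (hx n)
  have hlim : Tendsto (fun κ : ℝ => F (w x₀) (gradient φ x₀) (Lop μ₁ μ₂ j₁ j₂ φ x₀ + κ * k))
      (𝓝[>] 0) (𝓝 (F (w x₀) (gradient φ x₀) (Lop μ₁ μ₂ j₁ j₂ φ x₀))) := by
    have h1 : Continuous fun κ : ℝ =>
        F (w x₀) (gradient φ x₀) (Lop μ₁ μ₂ j₁ j₂ φ x₀ + κ * k) :=
      hF.comp (continuous_const.prodMk (continuous_const.prodMk (by fun_prop)))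
    have h2 := h1.tendsto 0
    simp only [zero_mul, add_zero] at h2
    exact h2.mono_left nhdsWithin_le_nhds
  exact le_of_tendsto hlim (eventually_nhdsWithin_of_forall fun κ hκ => key κ hκ)

/-- Perron's bump construction: a subsolution failing to be a supersolution can be increased. -/
theorem IsSubSol.exists_bump (H : JumpHyp μ₁ μ₂ j₁ j₂)
    (hF : Continuous fun t : ℝ × RE N × ℝ => F t.1 t.2.1 t.2.2)
    (hFm : ∀ (r : ℝ) (p : RE N) (l l' : ℝ), l ≤ l' → F r p l' ≤ F r p l) (hf : Continuous f)
    {w : RE N → ℝ} (hw : UniformContinuous w) (hwb : Bdd w)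
    (hws : IsSubSol μ₁ μ₂ j₁ j₂ F f w) {φ : RE N → ℝ} (hφ : TestFn φ) {x₀ : RE N}
    (hx₀ : ∀ y, w x₀ - φ x₀ ≤ w y - φ y)
    (hlt : F (w x₀) (gradient φ x₀) (Lop μ₁ μ₂ j₁ j₂ φ x₀) < f x₀) :
    ∃ U, UniformContinuous U ∧ Bdd U ∧ IsSubSol μ₁ μ₂ j₁ j₂ F f U ∧ w x₀ < U x₀ := by
  obtain ⟨k, hk⟩ := H.exists_Lop_add_well hφ x₀
  obtain ⟨κ, hκ, hκlt⟩ : ∃ κ > 0,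
      F (w x₀) (gradient φ x₀) (Lop μ₁ μ₂ j₁ j₂ φ x₀ + (-κ) * k) < f x₀ := by
    have h1 : Continuous fun κ : ℝ =>
        F (w x₀) (gradient φ x₀) (Lop μ₁ μ₂ j₁ j₂ φ x₀ + (-κ) * k) :=
      hF.comp (continuous_const.prodMk (continuous_const.prodMk (by fun_prop)))
    have h2 : ∀ᶠ κ : ℝ in 𝓝 0,
        F (w x₀) (gradient φ x₀) (Lop μ₁ μ₂ j₁ j₂ φ x₀ + (-κ) * k) < f x₀ :=
      (h1.tendsto 0).eventually_lt_const (by simpa using hlt)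
    obtain ⟨κ, h3, h4⟩ := ((h2.filter_mono nhdsWithin_le_nhds).and
      (self_mem_nhdsWithin (s := Set.Ioi (0 : ℝ)))).exists
    exact ⟨κ, h4, h3⟩
  obtain ⟨hΦ, hg, hL⟩ := hk (-κ)
  rw [← hg, ← hL] at hκlt
  set Φ : RE N → ℝ := fun y => φ y + (-κ) * well (y - x₀) with hΦdef
  have hΦ0 : Φ x₀ = φ x₀ := by simp [hΦdef, well_zero]
  have hΦc := hΦ.1.continuous
  set c := w x₀ - φ x₀ with hc
  have hwΦ : ∀ y, Φ y + c + κ * well (y - x₀) ≤ w y := by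
    intro y
    have : Φ y = φ y + (-κ) * well (y - x₀) := rfl
    linarith [hx₀ y]
  have hcont : Continuous fun t : ℝ × RE N =>
      F (Φ t.2 + c + t.1) (gradient Φ t.2) (Lop μ₁ μ₂ j₁ j₂ Φ t.2) - f t.2 := by
    refine Continuous.sub (hF.comp (Continuous.prodMk (by fun_prop) (Continuous.prodMk ?_ ?_)))
      (hf.comp continuous_snd)
    · exact (hΦ.1.continuous_gradient (by norm_num)).comp continuous_snd
    · exact (H.continuous_Lop hΦ).comp continuous_snd
  have hneg : ∀ᶠ t : ℝ × RE N in 𝓝 ((0 : ℝ), x₀),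
      F (Φ t.2 + c + t.1) (gradient Φ t.2) (Lop μ₁ μ₂ j₁ j₂ Φ t.2) - f t.2 < 0 := by
    refine (hcont.tendsto _).eventually_lt_const ?_
    have : Φ x₀ + c + 0 = w x₀ := by rw [hΦ0, hc]; ring
    simp only [this]
    linarith
  obtain ⟨r, hr, hball⟩ := Metric.eventually_nhds_iff.1 hneg
  set m : ℝ := r ^ 2 / (1 + r ^ 2) with hm
  have hm0 : 0 < m := by positivity
  set δ : ℝ := min (r / 2) (κ * m) with hδ
  have hδ0 : 0 < δ := lt_min (by positivity) (by positivity)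
  set Ψ : RE N → ℝ := fun y => Φ y + c + δ with hΨ
  have hΨt : TestFn Ψ := by
    obtain ⟨B, hB⟩ := hΦ.2
    refine ⟨(hΦ.1.add contDiff_const).add contDiff_const, B + |c| + δ, fun y => ?_⟩
    refine (abs_add_le _ _).trans (add_le_add ((abs_add_le _ _).trans (add_le_add (hB y) le_rfl)) ?_)
    rw [abs_of_pos hδ0]
  have hΨL : ∀ y, gradient Φ y = gradient Ψ y ∧
      Lop μ₁ μ₂ j₁ j₂ Ψ y ≤ Lop μ₁ μ₂ j₁ j₂ Φ y ∧ Lop μ₁ μ₂ j₁ j₂ Φ y ≤ Lop μ₁ μ₂ j₁ j₂ Ψ y :=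
    fun y => ⟨(H.Lop_le_Lop hΦ hΨt fun z => by simp only [hΨ]; linarith).1,
      (H.Lop_le_Lop hΨt hΦ fun z => by simp only [hΨ]; linarith).2,
      (H.Lop_le_Lop hΦ hΨt fun z => by simp only [hΨ]; linarith).2⟩
  have hfar : ∀ y, r ≤ dist y x₀ → Ψ y ≤ w y := by
    intro y hy
    rw [dist_eq_norm] at hy
    have h1 := mul_le_mul_of_nonneg_left (well_ge hr.le hy) hκ.le
    have h2 : δ ≤ κ * m := min_le_right _ _
    have h3 : Ψ y = Φ y + c + δ := rfl
    linarith [hwΦ y]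
  have hnear : ∀ y, w y < Ψ y → F (Ψ y) (gradient Φ y) (Lop μ₁ μ₂ j₁ j₂ Φ y) < f y := by
    intro y hy
    have h1 : dist y x₀ < r := by
      by_contra! h
      exact absurd (hfar y h) (not_le.2 hy)
    have h2 := @hball (δ, y) (by
      rw [Prod.dist_eq, max_lt_iff]
      refine ⟨?_, h1⟩
      rw [dist_zero_right, Real.norm_of_nonneg hδ0.le]
      exact (min_le_left _ _).trans_lt (by linarith))
    simp only at h2
    linarith
  refine ⟨fun y => max (w y) (Ψ y), ?_, ?_, ?_, ?_⟩
  · have h1 : Continuous fun y => max 0 (Ψ y - w y) := by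
      have := hw.continuous
      have := hΨt.1.continuous
      fun_prop
    have h2 : HasCompactSupport fun y => max 0 (Ψ y - w y) := by
      refine HasCompactSupport.intro (isCompact_closedBall x₀ r) fun y hy => ?_
      rw [Metric.mem_closedBall, not_le] at hy
      exact max_eq_left (by linarith [hfar y hy.le])
    have h3 := hw.add (h2.uniformContinuous_of_continuous h1)
    convert h3 using 1
    ext y
    rw [← max_add_add_left]
    simp
  · obtain ⟨A, hA⟩ := hwb
    obtain ⟨B, hB⟩ := hΨt.2
    exact ⟨max A B, fun y => abs_max_le_max_abs_abs.trans (max_le_max (hA y) (hB y))⟩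
  · intro ψ hψ x hx
    rcases le_or_gt (Ψ x) (w x) with h1 | h1
    · simp only [max_eq_left h1] at hx ⊢
      exact hws ψ hψ x fun y => (sub_le_sub_right (le_max_left _ _) _).trans (hx y)
    · simp only [max_eq_right h1.le] at hx ⊢
      obtain ⟨h2, h3⟩ := H.Lop_le_Lop hΨt hψ fun y =>
        (sub_le_sub_right (le_max_right _ _) _).trans (hx y)
      rw [← h2, ← (hΨL x).1]
      exact (hFm _ _ _ _ ((hΨL x).2.2.trans h3)).trans (hnear x h1).le
  · refine lt_max_of_lt_right ?_
    have h3 : Ψ x₀ = Φ x₀ + c + δ := rfl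
    linarith

theorem IsSubSol.comp_add_const_sub {γ : ℝ}
    (hF2 : ∀ (a b : ℝ) (p : RE N) (l : ℝ), b ≤ a → γ * (a - b) ≤ F a p l - F b p l)
    {u : RE N → ℝ} (hu : IsSubSol μ₁ μ₂ j₁ j₂ F f u) {h : RE N} {c : ℝ} (hc : 0 ≤ c)
    (hfc : ∀ x, f (x + h) ≤ f x + γ * c) :
    IsSubSol μ₁ μ₂ j₁ j₂ F f fun x => u (x + h) - c := by
  intro φ hφ x hx
  have e : x + h + -h = x := by abel
  have h1 := hu _ (hφ.comp_add_const (-h)) (x + h) fun y => by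
    have := hx (y + -h)
    simp only [neg_add_cancel_right] at this
    rw [e]
    linarith
  rw [gradient_comp_add_const, Lop_comp_add_const, e] at h1
  have h2 := hF2 (u (x + h)) (u (x + h) - c) (gradient φ x) (Lop μ₁ μ₂ j₁ j₂ φ x) (by linarith)
  rw [sub_sub_cancel] at h2
  linarith [hfc x]

/-- Existence by Perron's method. -/
theorem exists_viscosity_solution (H : JumpHyp μ₁ μ₂ j₁ j₂)
    (hF : Continuous fun t : ℝ × RE N × ℝ => F t.1 t.2.1 t.2.2)
    (hFm : ∀ (r : ℝ) (p : RE N) (l l' : ℝ), l ≤ l' → F r p l' ≤ F r p l)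
    {γ : ℝ} (hF2 : ∀ (a b : ℝ) (p : RE N) (l : ℝ), b ≤ a → γ * (a - b) ≤ F a p l - F b p l)
    (hγ : 0 < γ) (hF0 : F 0 0 0 = 0) (hf : UniformContinuous f) (hfb : Bdd f) :
    ∃ u, Bdd u ∧ UniformContinuous u ∧ IsSubSol μ₁ μ₂ j₁ j₂ F f u ∧
      IsSuperSol μ₁ μ₂ j₁ j₂ F f u := by
  obtain ⟨A, hA⟩ := id hfb
  have hA0 : 0 ≤ A := (abs_nonneg _).trans (hA 0)
  set K := A / γ with hK
  have hK0 : 0 ≤ K := by positivity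
  have hγK : γ * K = A := by rw [hK]; field_simp
  have hsubK : IsSubSol μ₁ μ₂ j₁ j₂ F f fun _ => -K := isSubSol_const H hFm fun x => by
    have := hF2 0 (-K) 0 0 (by linarith)
    rw [zero_sub, neg_neg] at this
    linarith [(abs_le.1 (hA x)).1]
  have hsuperK : IsSuperSol μ₁ μ₂ j₁ j₂ F f fun _ => K := isSuperSol_const H hFm fun x => by
    have := hF2 K 0 0 0 hK0
    rw [sub_zero] at this
    linarith [(abs_le.1 (hA x)).2]
  let S : Set (RE N → ℝ) := {u | UniformContinuous u ∧ Bdd u ∧ IsSubSol μ₁ μ₂ j₁ j₂ F f u}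
  have hSK : ∀ u ∈ S, ∀ x, u x ≤ K := fun u hu x =>
    comparison H hF hFm hF2 hγ hf hfb hu.1 uniformContinuous_const hu.2.1 (testFn_const K).2
      hu.2.2 hsuperK x
  have hKS : (fun _ => -K) ∈ S := ⟨uniformContinuous_const, (testFn_const _).2, hsubK⟩
  let w : RE N → ℝ := fun x => sSup ((fun u : RE N → ℝ => u x) '' S)
  have hbd : ∀ x, BddAbove ((fun u : RE N → ℝ => u x) '' S) := by
    intro x
    refine ⟨K, ?_⟩
    rintro _ ⟨u, hu, rfl⟩
    exact hSK u hu x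
  have huw : ∀ u ∈ S, ∀ x, u x ≤ w x := fun u hu x => le_csSup (hbd x) ⟨u, hu, rfl⟩
  have hne : ∀ x, ((fun u : RE N → ℝ => u x) '' S).Nonempty := fun x => ⟨_, _, hKS, rfl⟩
  have hwle : ∀ x c, (∀ u ∈ S, u x ≤ c) → w x ≤ c := by
    intro x c h
    refine csSup_le (hne x) ?_
    rintro _ ⟨u, hu, rfl⟩
    exact h u hu
  have hwb : Bdd w := ⟨K, fun x => abs_le.2 ⟨huw _ hKS x, hwle x K fun u hu => hSK u hu x⟩⟩
  have hwu : UniformContinuous w := by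
    rw [Metric.uniformContinuous_iff]
    intro e he
    obtain ⟨d, hd, h⟩ := Metric.uniformContinuous_iff.1 hf (γ * (e / 2)) (by positivity)
    have key : ∀ x y, dist x y < d → w y ≤ w x + e / 2 := by
      intro x y hxy
      refine hwle y _ fun u hu => ?_
      have hmem : (fun z => u (z + (y - x)) - e / 2) ∈ S := by
        refine ⟨?_, ?_, hu.2.2.comp_add_const_sub hF2 (by positivity) fun z => ?_⟩
        · have h1 : UniformContinuous fun z : RE N => z + (y - x) :=
            uniformContinuous_id.add uniformContinuous_const
          exact (hu.1.comp h1).sub uniformContinuous_const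
        · obtain ⟨B, hB⟩ := hu.2.1
          refine ⟨B + |e / 2|, fun z => (abs_sub _ _).trans ?_⟩
          linarith [hB (z + (y - x))]
        · have h1 := h (a := z + (y - x)) (b := z) (by
            rw [dist_eq_norm, add_sub_cancel_left, ← dist_eq_norm, dist_comm]
            exact hxy)
          rw [Real.dist_eq] at h1
          linarith [(abs_lt.1 h1).2]
      have := huw _ hmem x
      simp only [add_sub_cancel] at this
      linarith
    refine ⟨d, hd, fun x y hxy => ?_⟩
    have h1 := key x y hxy
    have h2 := key y x (by rwa [dist_comm])
    rw [Real.dist_eq, abs_lt]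
    constructor <;> linarith
  have hws : IsSubSol μ₁ μ₂ j₁ j₂ F f w := by
    refine isSubSol_of_approx H hF hf.continuous hwu.continuous fun x e he => ?_
    obtain ⟨_, ⟨u, hu, rfl⟩, hlt⟩ := exists_lt_of_lt_csSup (hne x) (show w x - e < w x by linarith)
    exact ⟨u, hu.1.continuous, hu.2.2, huw u hu, hlt⟩
  refine ⟨w, hwb, hwu, hws, fun φ hφ x hx => ?_⟩
  by_contra! hlt
  obtain ⟨U, hU, hUb, hUs, hUx⟩ := hws.exists_bump H hF hFm hf.continuous hwu hwb hφ hx hlt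
  exact absurd (huw U ⟨hU, hUb, hUs⟩ x) (not_le.2 hUx)

theorem existsUnique_viscosity_solution (H : JumpHyp μ₁ μ₂ j₁ j₂)
    (hF : Continuous fun t : ℝ × RE N × ℝ => F t.1 t.2.1 t.2.2)
    (hFm : ∀ (r : ℝ) (p : RE N) (l l' : ℝ), l ≤ l' → F r p l' ≤ F r p l)
    {γ : ℝ} (hF2 : ∀ (a b : ℝ) (p : RE N) (l : ℝ), b ≤ a → γ * (a - b) ≤ F a p l - F b p l)
    (hγ : 0 < γ) (hF0 : F 0 0 0 = 0) (hf : UniformContinuous f) (hfb : Bdd f) :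
    ∃! u, Bdd u ∧ UniformContinuous u ∧ IsSubSol μ₁ μ₂ j₁ j₂ F f u ∧
      IsSuperSol μ₁ μ₂ j₁ j₂ F f u := by
  obtain ⟨u, hub, hu, hus, huS⟩ := exists_viscosity_solution H hF hFm hF2 hγ hF0 hf hfb
  refine ⟨u, ⟨hub, hu, hus, huS⟩, ?_⟩
  rintro v ⟨hvb, hv, hvs, hvS⟩
  exact funext fun x => le_antisymm
    (comparison H hF hFm hF2 hγ hf hfb hv hu hvb hub hvs huS x)
    (comparison H hF hFm hF2 hγ hf hfb hu hv hub hvb hus hvS x)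

end Perron

section Hypotheses

variable {N P : ℕ} {μ₁ μ₂ : Measure (RE P)} {j₁ j₂ : RE N → RE P → RE N}

lemma integrable_norm_sq_of_lintegral_le {μ : Measure (RE P)} {g : RE P → RE N} (hg : Measurable g)
    {C : ℝ} (h : (∫⁻ z, (‖g z‖₊ : ℝ≥0∞) ^ 2 ∂μ) ≤ ENNReal.ofReal C) :
    Integrable (fun z => ‖g z‖ ^ 2) μ := by
  refine ⟨(hg.norm.pow_const 2).aestronglyMeasurable, ?_⟩
  refine lt_of_eq_of_lt ?_ (h.trans_lt ENNReal.ofReal_lt_top)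
  refine lintegral_congr fun z => ?_
  rw [enorm_pow, enorm_norm, enorm_eq_nnnorm]

lemma integral_norm_sq_le_of_lintegral_le {μ : Measure (RE P)} {g : RE P → RE N}
    (hg : Measurable g) {C : ℝ} (hC : 0 ≤ C)
    (h : (∫⁻ z, (‖g z‖₊ : ℝ≥0∞) ^ 2 ∂μ) ≤ ENNReal.ofReal C) :
    ∫ z, ‖g z‖ ^ 2 ∂μ ≤ C := by
  rw [integral_eq_lintegral_of_nonneg_ae (Eventually.of_forall fun z => by positivity)
    (hg.norm.pow_const 2).aestronglyMeasurable]
  refine ENNReal.toReal_le_of_le_ofReal hC (le_trans (le_of_eq ?_) h)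
  refine lintegral_congr fun z => ?_
  rw [ENNReal.ofReal_pow (norm_nonneg _), ofReal_norm, enorm_eq_nnnorm]

lemma JumpHyp.of_lintegral (hM2 : μ₂ Set.univ < ⊤)
    (hj₁m : Measurable (Function.uncurry j₁)) (hj₂m : Measurable (Function.uncurry j₂))
    (hj₁c : ∀ᵐ z ∂μ₁, Continuous fun p => j₁ p z)
    (hj₂c : ∀ᵐ z ∂μ₂, Continuous fun p => j₂ p z)
    (hJ1 : ∀ r > 0, ∃ C > 0, ∀ p : RE N, ‖p‖ < r →
      (∫⁻ z, (‖j₁ p z‖₊ : ℝ≥0∞) ^ 2 ∂μ₁) ≤ ENNReal.ofReal C)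
    (hJ2 : ∀ r > 0, ∃ ω : ℝ → ℝ, IsModulus ω ∧ ∀ p q : RE N, ‖p‖ < r → ‖q‖ < r →
      (∫⁻ z, (‖j₁ p z - j₁ q z‖₊ : ℝ≥0∞) ^ 2 ∂μ₁) ≤ ENNReal.ofReal (ω ‖p - q‖)) :
    JumpHyp μ₁ μ₂ j₁ j₂ := by
  have hm₁ : ∀ p, Measurable (j₁ p) := fun p => hj₁m.comp measurable_prodMk_left
  have hm₂ : ∀ p, Measurable (j₂ p) := fun p => hj₂m.comp measurable_prodMk_left
  refine ⟨⟨hM2⟩, hm₁, hm₂, hj₁c, hj₂c, fun p => ?_, fun r => ?_, fun p => ?_⟩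
  · obtain ⟨C, -, hC⟩ := hJ1 (‖p‖ + 1) (by positivity)
    exact integrable_norm_sq_of_lintegral_le (hm₁ p) (hC p (by linarith))
  · obtain ⟨C, hC0, hC⟩ := hJ1 (|r| + 1) (by positivity)
    exact ⟨C, fun p hp => integral_norm_sq_le_of_lintegral_le (hm₁ p) hC0.le
      (hC p (by linarith [le_abs_self r]))⟩
  · obtain ⟨ω, ⟨hω0, -, hω⟩, h⟩ := hJ2 (‖p‖ + 1) (by positivity)
    have hp : Tendsto (fun q => ∫ z, ‖j₁ q z - j₁ p z‖ ^ 2 ∂μ₁) (𝓝[≠] p) (𝓝 0) := by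
      have hd : Tendsto (fun q => ‖q - p‖) (𝓝[≠] p) (𝓝[>] 0) := tendsto_norm_sub_self_nhdsNE p
      refine squeeze_zero' (Eventually.of_forall fun q => by positivity) ?_ (hω.comp hd)
      have hb : ∀ᶠ q in 𝓝[≠] p, ‖q‖ < ‖p‖ + 1 :=
        (continuous_norm.continuousAt.eventually_lt continuousAt_const
          (lt_add_one ‖p‖)).filter_mono nhdsWithin_le_nhds
      filter_upwards [hb] with q hq
      exact integral_norm_sq_le_of_lintegral_le ((hm₁ q).sub (hm₁ p)) (hω0 _)
        (h q p hq (lt_add_one _))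
    rw [← nhdsNE_sup_pure]
    refine hp.sup ?_
    rw [tendsto_pure_left]
    intro s hs
    simpa using mem_of_mem_nhds hs

end Hypotheses

/-- Existence and uniqueness of a bounded uniformly continuous viscosity solution of
`F(u, Du, L[u,Du]) = f` in `ℝ^N`, and in particular of `-L[u,Du] + u = f`. -/
theorem existence_uniqueness
    (N P : ℕ) (hN : 1 ≤ N) (hP : 1 ≤ P)
    (μ₁ μ₂ : Measure (RE P)) (j₁ j₂ : RE N → RE P → RE N)
    (F : ℝ → RE N → ℝ → ℝ) (f : RE N → ℝ)
    -- (M)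
    (hM0 : μ₁ {0} = 0) (hM0' : μ₂ {0} = 0)
    (hM1 : (∫⁻ z, (‖z‖₊ : ℝ≥0∞) ^ 2 ∂μ₁) < ⊤)
    (hM2 : μ₂ Set.univ < ⊤)
    -- j measurable and continuous in p for a.e. z
    (hj₁m : Measurable (Function.uncurry j₁))
    (hj₂m : Measurable (Function.uncurry j₂))
    (hj₁c : ∀ᵐ z ∂μ₁, Continuous fun p => j₁ p z)
    (hj₂c : ∀ᵐ z ∂μ₂, Continuous fun p => j₂ p z)
    -- (J1)
    (hJ1 : ∀ r > 0, ∃ C > 0, ∀ p : RE N, ‖p‖ < r →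
      (∫⁻ z, (‖j₁ p z‖₊ : ℝ≥0∞) ^ 2 ∂μ₁) ≤ ENNReal.ofReal C)
    -- (J2)
    (hJ2 : ∀ r > 0, ∃ ω : ℝ → ℝ, IsModulus ω ∧ ∀ p q : RE N, ‖p‖ < r → ‖q‖ < r →
      (∫⁻ z, (‖j₁ p z - j₁ q z‖₊ : ℝ≥0∞) ^ 2 ∂μ₁) ≤ ENNReal.ofReal (ω ‖p - q‖))
    -- (J3)
    (hJ3 : ∃ δ₀ > (0:ℝ), ∀ r > (0:ℝ), ∀ ε > (0:ℝ), ∃ η > (0:ℝ),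
      ∀ A : Set (RE P), MeasurableSet A → A ⊆ {z : RE P | 0 < ‖z‖ ∧ ‖z‖ < δ₀} →
        (∫⁻ z in A, (‖z‖₊ : ℝ≥0∞) ^ 2 ∂μ₁) < ENNReal.ofReal η →
        ∀ p : RE N, ‖p‖ < r →
          (∫⁻ z in A, (‖j₁ p z‖₊ : ℝ≥0∞) ^ 2 ∂μ₁) < ENNReal.ofReal ε)
    -- (F1)
    (hF1c : Continuous fun t : ℝ × RE N × ℝ => F t.1 t.2.1 t.2.2)
    (hF1m : ∀ (r : ℝ) (p : RE N) (l l' : ℝ), l ≤ l' → F r p l' ≤ F r p l)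
    -- (F2) with γ independent of M
    (γ : ℝ) (hγ : 0 < γ)
    (hF2 : ∀ (a b : ℝ) (p : RE N) (l : ℝ), b ≤ a → γ * (a - b) ≤ F a p l - F b p l)
    -- (F3) with modulus independent of M
    (hF3 : ∀ r > 0, ∃ ω : ℝ → ℝ, IsModulus ω ∧
      ∀ (a : ℝ) (p q : RE N) (l l' : ℝ), ‖p‖ ≤ r → ‖q‖ ≤ r → |l| ≤ r → |l'| ≤ r →
        |F a p l - F a q l'| ≤ ω (‖p - q‖ + |l - l'|))
    -- normalization
    (hF0 : F 0 0 0 = 0)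
    -- (F5): f bounded and uniformly continuous
    (hf : UniformContinuous f) (hfb : ∃ C, ∀ x, |f x| ≤ C) :
    (∃! u : RE N → ℝ, Bdd u ∧ UniformContinuous u ∧
        IsSubSol μ₁ μ₂ j₁ j₂ F f u ∧ IsSuperSol μ₁ μ₂ j₁ j₂ F f u) ∧
    (∃! u : RE N → ℝ, Bdd u ∧ UniformContinuous u ∧
        IsSubSol μ₁ μ₂ j₁ j₂ (fun r _ l => -l + r) f u ∧
        IsSuperSol μ₁ μ₂ j₁ j₂ (fun r _ l => -l + r) f u) := by

  have H := JumpHyp.of_lintegral hM2 hj₁m hj₂m hj₁c hj₂c hJ1 hJ2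
  refine ⟨existsUnique_viscosity_solution H hF1c hF1m hF2 hγ hF0 hf hfb, ?_⟩
  refine existsUnique_viscosity_solution (F := fun r _ l => -l + r) H (by fun_prop) ?_
    (γ := 1) ?_ one_pos (by simp) hf hfb
  · intro r p l l' h
    exact add_le_add_left (neg_le_neg h) r
  · intro a b p l _
    linarith
end
end
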